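/- arXiv:1309.2174 — 12 statements merged into one kernel-verified Lean document; each statement's English description precedes it below -/
import Mathlib

section
/- Let X be a complete metric space, P a porosity-like relation on X, B a basis of open sets of X, and F a (B,P)-Foran scheme in X. Then every element of F is a non-σ-P-porous subset of X. -/
open Set Metric Filter Topology

/-- `P` is a porosity-like relation on the metric space `X`. -/
def IsPorosityLike (X : Type*) [MetricSpace X] (P : X → Set X → Prop) : Prop :=
  (∀ (x : X) (A B : Set X), A ⊆ B → P x B → P x A) ∧
  (∀ (x : X) (A : Set X), P x A ↔ ∃ r > 0, P x (A ∩ Metric.ball x r)) ∧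
  (∀ (x : X) (A : Set X), P x A ↔ P x (closure A))

/-- A set is `P`-porous if `P x A` holds at every point `x ∈ A`. -/
def PPorous {X : Type*} [MetricSpace X] (P : X → Set X → Prop) (A : Set X) : Prop :=
  ∀ x ∈ A, P x A

/-- A set is σ-`P`-porous if it is a countable union of `P`-porous sets. -/
def SigmaPPorous {X : Type*} [MetricSpace X] (P : X → Set X → Prop) (A : Set X) : Prop :=
  ∃ f : ℕ → Set X, (∀ n, PPorous P (f n)) ∧ A = ⋃ n, f n

/-- `ker_P(A) = A \ ⋃ {U : U open and U ∩ A is σ-P-porous}`. -/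
def kerP {X : Type*} [MetricSpace X] (P : X → Set X → Prop) (A : Set X) : Set X :=
  A \ ⋃₀ {U : Set X | IsOpen U ∧ SigmaPPorous P (U ∩ A)}

/-- `N_P(A) = {x ∈ A : ¬ P(x,A)}`. -/
def NP {X : Type*} [MetricSpace X] (P : X → Set X → Prop) (A : Set X) : Set X :=
  {x ∈ A | ¬ P x A}

/-- The initial segment `ν|n` of an infinite sequence `ν`, as a finite sequence. -/
def seg (ν : ℕ → ℕ) (n : ℕ) : List ℕ := (List.range n).map ν

/-- The Suslin operation applied to a Suslin scheme indexed by finite sequences. -/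
def SuslinOp {X : Type*} (A : List ℕ → Set X) : Set X :=
  ⋃ ν : ℕ → ℕ, ⋂ n : ℕ, A (seg ν n)

/-- A set is Suslin if it is the result of the Suslin operation applied to a scheme
of closed sets. -/
def IsSuslin {X : Type*} [TopologicalSpace X] (S : Set X) : Prop :=
  ∃ A : List ℕ → Set X, (∀ s, IsClosed (A s)) ∧ SuslinOp A = S

/-- `S` is a `(B,P)`-Foran scheme in `X`. -/
def IsForanScheme {X : Type*} [MetricSpace X] (B : Set (Set X)) (P : X → Set X → Prop)
    (S : List ℕ → Set X) : Prop :=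
  (∀ t, (S t).Nonempty) ∧
  (∀ t : List ℕ, (⋃ j : ℕ, S (t ++ [j])) ⊆ S t ∧ S t ⊆ closure (⋃ j : ℕ, S (t ++ [j]))) ∧
  (∀ (t : List ℕ) (k : ℕ), ∀ x ∈ S (t ++ [k]), ¬ P x (S t)) ∧
  (∀ (ν : ℕ → ℕ) (G : ℕ → Set X), (∀ n, G n ∈ B) →
    Filter.Tendsto (fun n => EMetric.diam (G n)) Filter.atTop (nhds 0) →
    (∀ n, closure (G (n + 1)) ⊆ G n) →
    (∀ n, (S (seg ν n) ∩ G n).Nonempty) →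
    (⋂ n, S (seg ν n) ∩ G n).Nonempty)

lemma foran_step
    {X : Type*} [MetricSpace X]
    (P : X → Set X → Prop) (hP : IsPorosityLike X P)
    (B : Set (Set X)) (hB : TopologicalSpace.IsTopologicalBasis B)
    (S : List ℕ → Set X) (hS : IsForanScheme B P S)
    (s : List ℕ) (G : Set X) (hG : IsOpen G) (hne : (S s ∩ G).Nonempty)
    (A : Set X) (hA : PPorous P A) (e : ENNReal) (he : 0 < e) :
    ∃ (j : ℕ) (G' : Set X), G' ∈ B ∧ closure G' ⊆ G ∧ Metric.ediam G' ≤ 2 * e ∧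
      (S (s ++ [j]) ∩ G').Nonempty ∧ S (s ++ [j]) ∩ G' ∩ A = ∅ := by
  obtain ⟨-, hd, hp, -⟩ := hS
  obtain ⟨h1, h2, h3⟩ := hP
  have shrink : ∀ x, ∀ H : Set X, IsOpen H → x ∈ H →
      ∃ G' ∈ B, x ∈ G' ∧ closure G' ⊆ H ∧ Metric.ediam G' ≤ 2 * e := by
    intro x H hH hx
    obtain ⟨G', hB', hx', hc⟩ := hB.exists_closure_subset
      (Filter.inter_mem (hH.mem_nhds hx) (Metric.eball_mem_nhds x he))
    refine ⟨G', hB', hx', fun y hy => (hc hy).1, ?_⟩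
    exact (Metric.ediam_mono (fun y hy => (hc (subset_closure hy)).2)).trans Metric.ediam_eball_le
  have hit : ∀ H : Set X, IsOpen H → (S s ∩ H).Nonempty →
      ∃ j x, x ∈ S (s ++ [j]) ∧ x ∈ H := by
    rintro H hH ⟨x, hx, hxH⟩
    obtain ⟨y, hyH, hy⟩ := mem_closure_iff.1 ((hd s).2 hx) H hH hxH
    obtain ⟨j, hj⟩ := mem_iUnion.1 hy
    exact ⟨j, y, hj, hyH⟩
  by_cases hc : S s ∩ G ⊆ closure (A ∩ S s)
  · obtain ⟨j, x, hx, hxG⟩ := hit G hG hne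
    obtain ⟨G', hB', hx', hcl, hdm⟩ := shrink x G hG hxG
    refine ⟨j, G', hB', hcl, hdm, ⟨x, hx, hx'⟩, ?_⟩
    rw [eq_empty_iff_forall_notMem]
    rintro y ⟨⟨hy, hyG⟩, hyA⟩
    have hyG : y ∈ G := hcl (subset_closure hyG)
    obtain ⟨r, hr, hrG⟩ := Metric.isOpen_iff.1 hG y hyG
    refine hp s j y hy ((h2 y _).2 ⟨r, hr, ?_⟩)
    refine h1 y _ (closure (A ∩ S s)) (fun z hz => hc ⟨hz.1, hrG hz.2⟩) ?_
    exact (h3 y _).1 (h1 y _ A inter_subset_left (hA y hyA))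
  · obtain ⟨x, ⟨hx, hxG⟩, hxc⟩ := not_subset.1 hc
    obtain ⟨j, y, hy, hyG, hyc⟩ := hit (G ∩ (closure (A ∩ S s))ᶜ)
      (hG.inter isClosed_closure.isOpen_compl) ⟨x, hx, hxG, hxc⟩
    obtain ⟨G', hB', hx', hcl, hdm⟩ := shrink y _
      (hG.inter isClosed_closure.isOpen_compl) ⟨hyG, hyc⟩
    refine ⟨j, G', hB', fun z hz => (hcl hz).1, hdm, ⟨y, hy, hx'⟩, ?_⟩
    rw [eq_empty_iff_forall_notMem]
    rintro z ⟨⟨hz, hzG⟩, hzA⟩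
    exact (hcl (subset_closure hzG)).2
      (subset_closure ⟨hzA, (hd s).1 (mem_iUnion.2 ⟨j, hz⟩)⟩)

lemma foran_mono {X : Type*} (S : List ℕ → Set X)
    (hd : ∀ t : List ℕ, (⋃ j : ℕ, S (t ++ [j])) ⊆ S t) (t u : List ℕ) :
    S (t ++ u) ⊆ S t := by
  induction u using List.reverseRecOn with
  | nil => simp
  | append_singleton u a ih =>
    rw [← List.append_assoc]
    exact fun x hx => ih (hd _ (mem_iUnion.2 ⟨a, hx⟩))

lemma seg_succ (ν : ℕ → ℕ) (n : ℕ) : seg ν (n + 1) = seg ν n ++ [ν n] := by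
  simp [seg, List.range_succ]

/-- Foran lemma: every element of a `(B,P)`-Foran scheme in a complete metric space,
where `B` is a basis of open sets and `P` a porosity-like relation,
is a non-σ-`P`-porous set. -/
theorem foran_scheme_elements_non_sigma_porous
    {X : Type*} [MetricSpace X] [CompleteSpace X]
    (P : X → Set X → Prop) (hP : IsPorosityLike X P)
    (B : Set (Set X)) (hB : TopologicalSpace.IsTopologicalBasis B)
    (S : List ℕ → Set X) (hS : IsForanScheme B P S) :
    ∀ t : List ℕ, ¬ SigmaPPorous P (S t) := by
  rintro t ⟨A, hA, hAt⟩
  have hS' := hS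
  obtain ⟨hn, hd, hp, hi⟩ := hS'
  obtain ⟨x, hx⟩ := hn t
  have hx0 : ∀ W : Set X, W ∈ B ∧ x ∈ W →
      ∃ W', (W' ∈ B ∧ x ∈ W') ∧ closure W' ⊆ W := by
    rintro W ⟨hW, hxW⟩
    obtain ⟨W', a, b, c⟩ := hB.exists_closure_subset ((hB.isOpen hW).mem_nhds hxW)
    exact ⟨W', ⟨a, b⟩, c⟩
  obtain ⟨W0, hW0, hxW0, -⟩ := hB.exists_closure_subset (Filter.univ_mem (f := 𝓝 x))
  choose! w hw1 hw2 using hx0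
  let H : ℕ → Set X := fun n => w^[n] W0
  have hHs : ∀ n, H (n + 1) = w (H n) := fun n => Function.iterate_succ_apply' w n W0
  have hH : ∀ n, H n ∈ B ∧ x ∈ H n := by
    intro n
    induction n with
    | zero => exact ⟨hW0, hxW0⟩
    | succ n ih => rw [hHs]; exact hw1 _ ih
  have hHc : ∀ n, closure (H (n + 1)) ⊆ H n := fun n => by rw [hHs]; exact hw2 _ (hH n)
  -- recursion
  have step : ∀ (n : ℕ) (q : List ℕ × Set X), ∃ jG : ℕ × Set X,
      (q.2 ∈ B ∧ (S q.1 ∩ q.2).Nonempty) →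
      jG.2 ∈ B ∧ closure jG.2 ⊆ q.2 ∧ Metric.ediam jG.2 ≤ 2 * ((n : ENNReal))⁻¹ ∧
      (S (q.1 ++ [jG.1]) ∩ jG.2).Nonempty ∧ S (q.1 ++ [jG.1]) ∩ jG.2 ∩ A n = ∅ := by
    intro n q
    by_cases h : q.2 ∈ B ∧ (S q.1 ∩ q.2).Nonempty
    · obtain ⟨j, G, hG⟩ := foran_step P hP B hB S hS q.1 q.2 (hB.isOpen h.1) h.2 (A n) (hA n)
        ((n : ENNReal))⁻¹ (by simp)
      exact ⟨(j, G), fun _ => hG⟩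
    · exact ⟨(0, ∅), fun h' => absurd h' h⟩
  choose f hf using step
  let q : ℕ → List ℕ × Set X := fun n =>
    Nat.rec (t, H t.length) (fun n p => (p.1 ++ [(f n p).1], (f n p).2)) n
  have hq0 : q 0 = (t, H t.length) := rfl
  have hqs : ∀ n, q (n + 1) = ((q n).1 ++ [(f n (q n)).1], (f n (q n)).2) := fun n => rfl
  have hq : ∀ n, (q n).2 ∈ B ∧ (S (q n).1 ∩ (q n).2).Nonempty := by
    intro n
    induction n with
    | zero => exact ⟨(hH _).1, x, hx, (hH _).2⟩
    | succ n ih =>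
      have := hf n (q n) ih
      rw [hqs]
      exact ⟨this.1, this.2.2.2.1⟩
  let ν : ℕ → ℕ := fun n => if h : n < t.length then t[n] else (f (n - t.length) (q (n - t.length))).1
  have hν1 : ∀ n, n ≤ t.length → seg ν n = t.take n := by
    intro n
    induction n with
    | zero => intro _; simp [seg]
    | succ n ih =>
      intro h
      have h' : n < t.length := h
      rw [seg_succ, ih h'.le, List.take_succ_eq_append_getElem h']
      simp [ν, h']
  have hν2 : ∀ k, seg ν (t.length + k) = (q k).1 := by
    intro k
    induction k with
    | zero => simp [hν1, hq0]
    | succ k ih =>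
      rw [← add_assoc, seg_succ, ih, hqs]
      simp [ν]
  let G : ℕ → Set X := fun n => if n ≤ t.length then H n else (q (n - t.length)).2
  have hG1 : ∀ n, n ≤ t.length → G n = H n := fun n h => by simp [G, h]
  have hG2 : ∀ k, G (t.length + k) = (q k).2 := by
    intro k
    cases k with
    | zero => simp [hG1, hq0]
    | succ k => simp [G]
  have key := hi ν G ?_ ?_ ?_ ?_
  · obtain ⟨y, hy⟩ := key
    have hy' : ∀ k, y ∈ S (q k).1 ∩ (q k).2 := by
      intro k
      have := mem_iInter.1 hy (t.length + k)
      rwa [hν2, hG2] at this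
    have hyt : y ∈ S t := (hy' 0).1
    rw [hAt] at hyt
    obtain ⟨n, hn⟩ := mem_iUnion.1 hyt
    have h5 := (hf n (q n) (hq n)).2.2.2.2
    have h6 := hy' (n + 1)
    rw [hqs] at h6
    exact (eq_empty_iff_forall_notMem.1 h5 y) ⟨h6, hn⟩
  · intro n
    rcases le_total n t.length with h | h
    · rw [hG1 n h]; exact (hH n).1
    · obtain ⟨k, rfl⟩ := Nat.exists_eq_add_of_le h
      rw [hG2]; exact (hq k).1
  · rw [← tendsto_add_atTop_iff_nat (t.length + 1)]
    have h0 : Tendsto (fun n : ℕ => 2 * ((n : ENNReal))⁻¹) atTop (𝓝 0) := by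
      have := ENNReal.Tendsto.const_mul (a := 2) ENNReal.tendsto_inv_nat_nhds_zero
        (Or.inr (by simp))
      simpa using this
    refine tendsto_of_tendsto_of_tendsto_of_le_of_le tendsto_const_nhds h0
      (fun _ => zero_le) (fun n => ?_)
    have e : n + (t.length + 1) = t.length + (n + 1) := by omega
    change Metric.ediam (G (n + (t.length + 1))) ≤ _
    rw [e, hG2, hqs]
    exact (hf n (q n) (hq n)).2.2.1
  · intro n
    rcases Nat.lt_or_ge n t.length with h | h
    · rw [hG1 n h.le, hG1 (n + 1) h]; exact hHc n
    · obtain ⟨k, rfl⟩ := Nat.exists_eq_add_of_le h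
      rw [add_assoc, hG2, hG2, hqs]; exact (hf k (q k) (hq k)).2.1
  · intro n
    rcases le_total n t.length with h | h
    · rw [hG1 n h, hν1 n h]
      refine ⟨x, ?_, (hH n).2⟩
      apply foran_mono S (fun t => (hd t).1) (t.take n) (t.drop n)
      rwa [List.take_append_drop]
    · obtain ⟨k, rfl⟩ := Nat.exists_eq_add_of_le h
      rw [hG2, hν2]; exact (hq k).2
end

section
/- Let X be a complete metric space, P a porosity-like relation on X, and A ⊆ X. Then A \ ker_P(A) is σ-P-porous. -/
open Set Metric Filter Topology

/-- For a porosity-like relation `P` on a complete metric space `X` and `A ⊆ X`,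
the set `A \ ker_P(A)` is σ-`P`-porous. -/
theorem diff_kerP_sigma_porous
    {X : Type*} [MetricSpace X] [CompleteSpace X]
    (P : X → Set X → Prop) (hP : IsPorosityLike X P) (A : Set X) :
    SigmaPPorous P (A \ kerP P A) := by
  classical
  obtain ⟨hmono, hloc, -⟩ := hP
  set C : Set (Set X) := {U : Set X | IsOpen U ∧ SigmaPPorous P (U ∩ A)} with hC
  have hf : ∀ U : Set X, ∃ f : ℕ → Set X, U ∈ C → (∀ n, PPorous P (f n)) ∧ U ∩ A = ⋃ n, f n := by
    intro U
    by_cases h : U ∈ C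
    · obtain ⟨f, hf⟩ := h.2
      exact ⟨f, fun _ => hf⟩
    · exact ⟨fun _ => ∅, fun h' => absurd h' h⟩
  choose f hf using hf
  let S : ℕ → Set X → Set X := fun n U =>
    {x | U ∈ C ∧ x ∈ U ∧ (∀ V ∈ C, x ∈ V → ¬ WellOrderingRel V U) ∧
      ball x (1 / ((n : ℝ) + 1)) ⊆ U}
  have hsep : ∀ n U V x y, x ∈ S n U → y ∈ S n V → dist y x < 1 / ((n : ℝ) + 1) → U = V := by
    intro n U V x y hx hy hd
    have hyU : y ∈ U := hx.2.2.2 hd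
    have hxV : x ∈ V := hy.2.2.2 (by rw [mem_ball, dist_comm]; exact hd)
    have h1 := hy.2.2.1 U hx.1 hyU
    have h2 := hx.2.2.1 V hy.1 hxV
    rcases trichotomous_of WellOrderingRel U V with h | h | h
    · exact absurd h h1
    · exact h
    · exact absurd h h2
  refine ⟨fun k => ⋃ U, f U k.unpair.1 ∩ S k.unpair.2 U, ?_, ?_⟩
  · intro k x hx
    obtain ⟨U, hxf, hxS⟩ := mem_iUnion.1 hx
    refine (hloc x _).2 ⟨1 / ((k.unpair.2 : ℝ) + 1), by positivity, ?_⟩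
    refine hmono x _ (f U k.unpair.1) ?_ (((hf U hxS.1).1 _) x hxf)
    rintro y ⟨hy, hyb⟩
    obtain ⟨V, hyf, hyS⟩ := mem_iUnion.1 hy
    have := hsep _ U V x y hxS hyS hyb
    rw [this]; exact hyf
  · ext x
    constructor
    · rintro ⟨hxA, hxk⟩
      have hx : ∃ U, U ∈ C ∧ x ∈ U := by
        by_contra h
        exact hxk ⟨hxA, fun ⟨U, hU, hxU⟩ => h ⟨U, hU, hxU⟩⟩
      have wf : WellFounded (WellOrderingRel : Set X → Set X → Prop) := IsWellFounded.wf
      obtain ⟨U, ⟨hUC, hxU⟩, hmin⟩ := wf.has_min {U | U ∈ C ∧ x ∈ U} hx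
      obtain ⟨e, he, hball⟩ := Metric.isOpen_iff.1 hUC.1 x hxU
      obtain ⟨n, hn⟩ := exists_nat_one_div_lt he
      have hxm : x ∈ ⋃ m, f U m := (hf U hUC).2 ▸ ⟨hxU, hxA⟩
      obtain ⟨m, hm⟩ := mem_iUnion.1 hxm
      refine mem_iUnion.2 ⟨Nat.pair m n, mem_iUnion.2 ⟨U, ?_⟩⟩
      rw [Nat.unpair_pair]
      exact ⟨hm, hUC, hxU, fun V hV hxV => hmin V ⟨hV, hxV⟩,
        (ball_subset_ball hn.le).trans hball⟩
    · intro hx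
      obtain ⟨k, hx⟩ := mem_iUnion.1 hx
      obtain ⟨U, hxf, hxS⟩ := mem_iUnion.1 hx
      have hxA : x ∈ U ∩ A := (hf U hxS.1).2 ▸ mem_iUnion.2 ⟨_, hxf⟩
      exact ⟨hxA.2, fun h => h.2 ⟨U, hxS.1, hxA.1⟩⟩
end

section
/- Let X be a complete metric space, P a porosity-like relation on X, and A ⊆ X. Then ker_P(ker_P(A)) = ker_P(A). -/
open Set Metric Filter Topology

theorem sigma_of_cover {X : Type*} [MetricSpace X] {P : X → Set X → Prop}
    (hP : IsPorosityLike X P) {ι : Type*} [Countable ι] [Nonempty ι] {A : Set X}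
    (f : ι → Set X) (hf : ∀ i, PPorous P (f i)) (hA : A ⊆ ⋃ i, f i) : SigmaPPorous P A := by
  obtain ⟨e, he⟩ := exists_surjective_nat ι
  refine ⟨fun n => A ∩ f (e n), fun n x hx => hP.1 x _ _ inter_subset_right (hf _ x hx.2), ?_⟩
  ext x
  simp only [mem_iUnion, mem_inter_iff]
  constructor
  · intro hx
    obtain ⟨i, hi⟩ := mem_iUnion.1 (hA hx)
    obtain ⟨n, rfl⟩ := he i
    exact ⟨n, hx, hi⟩
  · rintro ⟨n, hx, -⟩
    exact hx

theorem sigma_local {X : Type*} [MetricSpace X] {P : X → Set X → Prop}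
    (hP : IsPorosityLike X P) (A : Set X) :
    SigmaPPorous P ((⋃₀ {U : Set X | IsOpen U ∧ SigmaPPorous P (U ∩ A)}) ∩ A) := by
  set F := {U : Set X | IsOpen U ∧ SigmaPPorous P (U ∩ A)} with hF
  have h1 : ∀ x : X, ∃ U : Set X, x ∈ ⋃₀ F →
      (U ∈ F ∧ x ∈ U ∧ ∀ V ∈ F, x ∈ V → ¬ WellOrderingRel V U) := by
    intro x
    by_cases hx : x ∈ ⋃₀ F
    · obtain ⟨V, hV, hxV⟩ := hx
      obtain ⟨U, hU, hm⟩ := (IsWellFounded.wf (r := (WellOrderingRel : Set X → Set X → Prop))).has_min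
        {U | U ∈ F ∧ x ∈ U} ⟨V, hV, hxV⟩
      exact ⟨U, fun _ => ⟨hU.1, hU.2, fun W hW hxW => hm W ⟨hW, hxW⟩⟩⟩
    · exact ⟨∅, fun h => absurd h hx⟩
  choose u hu using h1
  have h2 : ∀ U : Set X, ∃ f : ℕ → Set X, U ∈ F → (∀ n, PPorous P (f n)) ∧ U ∩ A = ⋃ n, f n := by
    intro U
    by_cases hU : U ∈ F
    · obtain ⟨f, hf⟩ := hU.2
      exact ⟨f, fun _ => hf⟩
    · exact ⟨fun _ => ∅, fun h => absurd h hU⟩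
  choose f hf using h2
  refine sigma_of_cover hP (ι := ℕ × ℕ)
    (fun p => {x | x ∈ ⋃₀ F ∧ ball x (1 / ((p.1 : ℝ) + 1)) ⊆ u x ∧ x ∈ f (u x) p.2}) ?_ ?_
  · rintro ⟨n, k⟩ x ⟨hxF, hb, hxf⟩
    refine (hP.2.1 x _).2 ⟨1 / ((n : ℝ) + 1), by positivity, ?_⟩
    refine hP.1 x _ (f (u x) k) ?_ ((hf _ (hu x hxF).1).1 k x hxf)
    rintro y ⟨⟨hyF, hyb, hyf⟩, hy⟩
    have e1 := (hu y hyF).2.2 (u x) (hu x hxF).1 (hb hy)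
    have e2 := (hu x hxF).2.2 (u y) (hu y hyF).1 (hyb (mem_ball_comm.1 hy))
    have e : u x = u y := by
      rcases trichotomous_of (WellOrderingRel : Set X → Set X → Prop) (u x) (u y) with h | h | h
      · exact absurd h e1
      · exact h
      · exact absurd h e2
    rw [e]
    exact hyf
  · rintro x ⟨hxF, hxA⟩
    obtain ⟨hU, hxU, -⟩ := hu x hxF
    obtain ⟨ε, hε, hb⟩ := Metric.isOpen_iff.1 hU.1 x hxU
    obtain ⟨n, hn⟩ := exists_nat_one_div_lt hε
    have : x ∈ ⋃ n, f (u x) n := (hf _ hU).2 ▸ ⟨hxU, hxA⟩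
    obtain ⟨k, hk⟩ := mem_iUnion.1 this
    exact mem_iUnion.2 ⟨(n, k), hxF, (ball_subset_ball hn.le).trans hb, hk⟩

/-- For a porosity-like relation `P` on a complete metric space `X` and `A ⊆ X`,
`ker_P(ker_P(A)) = ker_P(A)`. -/
theorem kerP_idempotent
    {X : Type*} [MetricSpace X] [CompleteSpace X]
    (P : X → Set X → Prop) (hP : IsPorosityLike X P) (A : Set X) :
    kerP P (kerP P A) = kerP P A := by
  refine Subset.antisymm (fun x hx => hx.1) (fun x hx => ⟨hx, ?_⟩)
  rintro ⟨U, ⟨hUo, g, hg, hgU⟩, hxU⟩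
  obtain ⟨f, hf, hfA⟩ := sigma_local hP A
  refine hx.2 ⟨U, ⟨hUo, ?_⟩, hxU⟩
  refine sigma_of_cover hP (ι := ℕ ⊕ ℕ) (Sum.elim f g) ?_ ?_
  · rintro (n | n)
    · exact hf n
    · exact hg n
  · rintro y ⟨hyU, hyA⟩
    by_cases hy : y ∈ ⋃₀ {U : Set X | IsOpen U ∧ SigmaPPorous P (U ∩ A)}
    · have : y ∈ ⋃ n, f n := hfA ▸ ⟨hy, hyA⟩
      obtain ⟨n, hn⟩ := mem_iUnion.1 this
      exact mem_iUnion.2 ⟨Sum.inl n, hn⟩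
    · have : y ∈ ⋃ n, g n := hgU ▸ ⟨hyU, hyA, hy⟩
      obtain ⟨n, hn⟩ := mem_iUnion.1 this
      exact mem_iUnion.2 ⟨Sum.inr n, hn⟩
end

section
/- Let X be a complete metric space, P a porosity-like relation on X, and A ⊆ X a Suslin set. Then ker_P(A) is a Suslin set. -/
open Set Metric Filter Topology

/-- For a porosity-like relation `P` on a complete metric space `X`,
if `A ⊆ X` is Suslin then `ker_P(A)` is Suslin. -/
theorem kerP_suslin
    {X : Type*} [MetricSpace X] [CompleteSpace X]
    (P : X → Set X → Prop) (hP : IsPorosityLike X P)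
    (A : Set X) (hA : IsSuslin A) :
    IsSuslin (kerP P A) := by
  obtain ⟨S, hS, rfl⟩ := hA
  generalize hV : ⋃₀ {U : Set X | IsOpen U ∧ SigmaPPorous P (U ∩ SuslinOp S)} = V
  have hVo : IsOpen V := hV ▸ isOpen_sUnion (fun U hU => hU.1)
  refine ⟨fun s => S s ∩ Vᶜ, fun s => (hS s).inter hVo.isClosed_compl, ?_⟩
  unfold kerP
  rw [hV]
  ext x
  simp only [SuslinOp, mem_iUnion, mem_iInter, mem_inter_iff, mem_compl_iff, mem_diff]
  constructor
  · rintro ⟨ν, h⟩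
    exact ⟨⟨ν, fun n => (h n).1⟩, (h 0).2⟩
  · rintro ⟨⟨ν, h⟩, hx⟩
    exact ⟨ν, fun n => ⟨h n, hx⟩⟩
end

section
/- Let X be a complete metric space, P a porosity-like relation on X, and A ⊆ B ⊆ X. If ker_P(B) = B and B \ A is σ-P-porous, then ker_P(A) = A. -/
open Set Metric Filter Topology

/-- For a porosity-like relation `P` on a complete metric space `X` and `A ⊆ B ⊆ X`,
if `ker_P(B) = B` and `B \ A` is σ-`P`-porous, then `ker_P(A) = A`. -/
theorem kerP_eq_of_diff_sigma_porous
    {X : Type*} [MetricSpace X] [CompleteSpace X]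
    (P : X → Set X → Prop) (hP : IsPorosityLike X P)
    (A B : Set X) (hAB : A ⊆ B) (hB : kerP P B = B)
    (hdiff : SigmaPPorous P (B \ A)) :
    kerP P A = A := by
  apply Subset.antisymm (fun x hx => hx.1)
  intro x hx
  refine ⟨hx, ?_⟩
  rintro ⟨U, ⟨hU, f, hf, hfU⟩, hxU⟩
  obtain ⟨g, hg, hgU⟩ := hdiff
  have hxB : x ∈ kerP P B := by rw [hB]; exact hAB hx
  refine hxB.2 ⟨U, ⟨hU, fun n => if n % 2 = 0 then f (n / 2) else U ∩ g (n / 2), ?_, ?_⟩, hxU⟩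
  · intro n
    by_cases h : n % 2 = 0
    · simp only [h, if_true]
      exact hf _
    · simp only [h, if_false]
      intro y hy
      exact hP.1 y _ _ inter_subset_right (hg _ y hy.2)
  · ext y
    constructor
    · rintro ⟨hyU, hyB⟩
      by_cases hyA : y ∈ A
      · have h : y ∈ ⋃ n, f n := hfU ▸ (⟨hyU, hyA⟩ : y ∈ U ∩ A)
        obtain ⟨n, hn⟩ := mem_iUnion.1 h
        refine mem_iUnion.2 ⟨2 * n, ?_⟩
        simpa using hn
      · have h : y ∈ ⋃ n, g n := hgU ▸ (⟨hyB, hyA⟩ : y ∈ B \ A)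
        obtain ⟨n, hn⟩ := mem_iUnion.1 h
        refine mem_iUnion.2 ⟨2 * n + 1, ?_⟩
        have h1 : (2 * n + 1) % 2 = 1 := by omega
        have h2 : (2 * n + 1) / 2 = n := by omega
        simp only [h1, h2]
        exact ⟨hyU, hn⟩
    · intro hy
      obtain ⟨n, hn⟩ := mem_iUnion.1 hy
      by_cases h : n % 2 = 0
      · simp only [h, if_true] at hn
        have h3 : y ∈ U ∩ A := hfU ▸ mem_iUnion.2 ⟨_, hn⟩
        exact ⟨h3.1, hAB h3.2⟩
      · simp only [h, if_false] at hn
        have h3 : y ∈ B \ A := hgU ▸ mem_iUnion.2 ⟨_, hn.2⟩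
        exact ⟨hn.1, h3.1⟩
end

section
/- Let X be a complete metric space, let A = {A(s) : s ∈ ω^{<ω}} be a Suslin scheme consisting of closed subsets of X, and let C ⊆ S(A) be a Suslin set. Then there exists a Suslin scheme C consisting of closed subsets of X which is subordinate to A and satisfies S(C) = C. -/
open Set Metric Filter Topology

/-- A Suslin scheme `C` is subordinate to a Suslin scheme `A`. -/
def Subordinate {X : Type*} (C A : List ℕ → Set X) : Prop :=
  ∃ φ : List ℕ → List ℕ,
    (∀ s, (φ s).length = s.length) ∧
    (∀ s t : List ℕ, s <+: t → φ s <+: φ t) ∧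
    (∀ s, C s ⊆ A (φ s))

/-- Given a Suslin scheme `A` of closed sets in a complete metric space and a Suslin set
`C ⊆ S(A)`, there is a Suslin scheme of closed sets subordinate to `A` whose value under
the Suslin operation is `C`. -/
theorem exists_subordinate_scheme
    {X : Type*} [MetricSpace X] [CompleteSpace X]
    (A : List ℕ → Set X) (hA : ∀ s, IsClosed (A s))
    (C : Set X) (hC : IsSuslin C) (hCA : C ⊆ SuslinOp A) :
    ∃ Cs : List ℕ → Set X, (∀ s, IsClosed (Cs s)) ∧ Subordinate Cs A ∧ SuslinOp Cs = C := by
  obtain ⟨D, hD, rfl⟩ := hC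
  have key : ∀ (f : ℕ → ℕ) (ν : ℕ → ℕ) (n : ℕ), (seg ν n).map f = seg (fun i => f (ν i)) n := by
    intro f ν n
    simp [seg, List.map_map, Function.comp_def]
  refine ⟨fun s => A (s.map fun k => k.unpair.1) ∩ D (s.map fun k => k.unpair.2),
    fun s => (hA _).inter (hD _),
    ⟨fun s => s.map fun k => k.unpair.1, fun s => by simp, fun s t h => h.map _,
      fun s => Set.inter_subset_left⟩, ?_⟩
  ext x
  constructor
  · intro hx
    simp only [SuslinOp, Set.mem_iUnion, Set.mem_iInter, key] at hx ⊢
    obtain ⟨ν, hν⟩ := hx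
    exact ⟨_, fun n => (hν n).2⟩
  · intro hx
    have hx' := hCA hx
    simp only [SuslinOp, Set.mem_iUnion, Set.mem_iInter, key] at hx hx' ⊢
    obtain ⟨μ, hμ⟩ := hx
    obtain ⟨ν, hν⟩ := hx'
    refine ⟨fun i => Nat.pair (ν i) (μ i), fun n => ?_⟩
    simp only [Nat.unpair_pair]
    exact ⟨hν n, hμ n⟩
end

section
/- Let (X,ρ) be a metric space and Y ⊆ X a subset which is complete with the induced metric. Let x_n ∈ Y and r_n > 0 (n ∈ ℕ) be such that, writing U_Y^n = {y ∈ Y : ρ(x_n,y) < r_n} for the open ball in Y, the following hold: (i) r_n → 0; (ii) for each n, the closure of U_Y^{n+1} taken in Y is contained in U_Y^n. Write U_X^n = {x ∈ X : ρ(x_n,x) < r_n} for the corresponding open ball in X. Then there exists a strictly increasing sequence of indices n(1) < n(2) < ⋯ such that for each k, the closure of U_X^{n(k+1)} taken in X is contained in U_X^{n(k)}. -/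
open Set Metric Filter Topology

/-- Let `(X,ρ)` be a metric space and `Y ⊆ X` a complete subset. Given centers `x n ∈ Y`
and radii `r n > 0` such that `r n → 0` and the closure in `Y` of the ball
`U_Y(x (n+1), r (n+1))` is contained in `U_Y(x n, r n)`, there is a strictly increasing
sequence of indices `n k` such that the closure in `X` of `U_X(x (n (k+1)), r (n (k+1)))`
is contained in `U_X(x (n k), r (n k))`. -/
theorem exists_subseq_closure_ball_subset
    {X : Type*} [MetricSpace X] (Y : Set X) (hY : IsComplete Y)
    (x : ℕ → X) (r : ℕ → ℝ) (hxY : ∀ n, x n ∈ Y) (hr : ∀ n, 0 < r n)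
    (hlim : Filter.Tendsto r Filter.atTop (nhds 0))
    (hnest : ∀ n,
      closure (Metric.ball (x (n + 1)) (r (n + 1)) ∩ Y) ∩ Y ⊆ Metric.ball (x n) (r n) ∩ Y) :
    ∃ nk : ℕ → ℕ, StrictMono nk ∧
      ∀ k, closure (Metric.ball (x (nk (k + 1))) (r (nk (k + 1)))) ⊆
        Metric.ball (x (nk k)) (r (nk k)) := by
  have hsub : Antitone (fun n => Metric.ball (x n) (r n) ∩ Y) := by
    apply antitone_nat_of_succ_le
    intro n z hz
    exact hnest n ⟨subset_closure hz, hz.2⟩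
  have hmem : ∀ n m, n ≤ m → x m ∈ Metric.ball (x n) (r n) ∩ Y := fun n m h =>
    hsub h ⟨Metric.mem_ball_self (hr m), hxY m⟩
  have hc : CauchySeq x := by
    refine cauchySeq_of_le_tendsto_0' r (fun n m h => ?_) hlim
    have := (hmem n m h).1
    rw [Metric.mem_ball'] at this
    exact this.le
  obtain ⟨p, hpY, hp⟩ := cauchySeq_tendsto_of_isComplete hY hxY hc
  have hpb : ∀ n, dist p (x n) < r n := by
    intro n
    refine (hnest n ⟨mem_closure_of_tendsto hp ?_, hpY⟩).1
    filter_upwards [Filter.eventually_ge_atTop (n + 1)] with m hm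
    exact hmem (n + 1) m hm
  have key : ∀ n, ∃ m, n < m ∧ closure (Metric.ball (x m) (r m)) ⊆ Metric.ball (x n) (r n) := by
    intro n
    have h1 : 0 < (r n - dist p (x n)) / 2 := by linarith [hpb n]
    obtain ⟨m, hm, hnm⟩ :=
      ((hlim.eventually (gt_mem_nhds h1)).and (Filter.eventually_gt_atTop n)).exists
    refine ⟨m, hnm, fun z hz => ?_⟩
    have hz' : dist z (x m) ≤ r m := Metric.closure_ball_subset_closedBall hz
    rw [Metric.mem_ball]
    have h2 := dist_triangle z (x m) (x n)
    have h3 := dist_triangle (x m) p (x n)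
    have h4 := hpb m
    rw [dist_comm] at h4
    linarith
  choose f hf1 hf2 using key
  refine ⟨fun k => f^[k] 0, strictMono_nat_of_lt_succ fun k => ?_, fun k => ?_⟩
  · rw [Function.iterate_succ_apply']
    exact hf1 _
  · simp only [Function.iterate_succ_apply']
    exact hf2 _
end

section
/- Let X be a real Banach space, x* ∈ X* a continuous linear functional, and α ∈ [0,1). Then for each x ∈ C(x*,α) one has dist(X \ C(x*,α), x + C(x*,α)) > 0, i.e. the distance between the complement of the α-cone C(x*,α) and its translate x + C(x*,α) is positive. -/
open Set Metric Filter Topology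

/-- The α-cone `C(x*, α) = {x : α‖x‖·‖x*‖ < x*(x)}` for a functional `x*` on a real
normed space. -/
def ConeSet {E : Type*} [NormedAddCommGroup E] [NormedSpace ℝ E]
    (f : E →L[ℝ] ℝ) (α : ℝ) : Set E :=
  {x : E | α * ‖x‖ * ‖f‖ < f x}

/-- `A` is α-cone porous at `x`: there is `R > 0` such that for each `ε > 0` there are
`z ∈ U(x,ε)` and `x* ≠ 0` with `U(x,R) ∩ (z + C(x*,α)) ∩ A = ∅`. -/
def ConePorousAt {E : Type*} [NormedAddCommGroup E] [NormedSpace ℝ E]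
    (α : ℝ) (A : Set E) (x : E) : Prop :=
  ∃ R > (0 : ℝ), ∀ ε > (0 : ℝ), ∃ z ∈ Metric.ball x ε, ∃ f : E →L[ℝ] ℝ, f ≠ 0 ∧
    Metric.ball x R ∩ ((z + ·) '' ConeSet f α) ∩ A = ∅

/-- `A` is α-cone porous if it is α-cone porous at each of its points. -/
def ConePorous {E : Type*} [NormedAddCommGroup E] [NormedSpace ℝ E]
    (α : ℝ) (A : Set E) : Prop :=
  ∀ x ∈ A, ConePorousAt α A x

/-- `A` is σ-α-cone porous if it is a countable union of α-cone porous sets. -/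
def SigmaConePorous {E : Type*} [NormedAddCommGroup E] [NormedSpace ℝ E]
    (α : ℝ) (A : Set E) : Prop :=
  ∃ g : ℕ → Set E, (∀ n, ConePorous α (g n)) ∧ A = ⋃ n, g n

/-- `A` is cone small if it is σ-α-cone porous for every `α ∈ (0,1)`. -/
def ConeSmall {E : Type*} [NormedAddCommGroup E] [NormedSpace ℝ E] (A : Set E) : Prop :=
  ∀ α : ℝ, α ∈ Set.Ioo (0 : ℝ) 1 → SigmaConePorous α A

/-- For a real Banach space `X`, `x* ∈ X*` and `α ∈ [0,1)`, for each `x ∈ C(x*,α)` the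
distance between `X \ C(x*,α)` and `x + C(x*,α)` is positive. -/
theorem dist_compl_cone_translate_pos
    {X : Type*} [NormedAddCommGroup X] [NormedSpace ℝ X] [CompleteSpace X]
    (f : X →L[ℝ] ℝ) (α : ℝ) (hα : α ∈ Set.Ico (0 : ℝ) 1)
    (x : X) (hx : x ∈ ConeSet f α) :
    ∃ δ > (0 : ℝ), ∀ a ∈ (ConeSet f α)ᶜ, ∀ b ∈ (x + ·) '' ConeSet f α, δ ≤ dist a b := by
  have hx' : α * ‖x‖ * ‖f‖ < f x := hx
  obtain ⟨h0, h1⟩ := hα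
  have hn : 0 ≤ ‖f‖ := norm_nonneg f
  have hp : 0 < 2 * ‖f‖ + 1 := by linarith
  refine ⟨(f x - α * ‖x‖ * ‖f‖) / (2 * ‖f‖ + 1), div_pos (by linarith) hp, ?_⟩
  rintro a ha b ⟨c, hc, rfl⟩
  have hc' : α * ‖c‖ * ‖f‖ < f c := hc
  have ha' : f a ≤ α * ‖a‖ * ‖f‖ := not_lt.mp ha
  rw [div_le_iff₀ hp, dist_eq_norm]
  change _ ≤ ‖a - (x + c)‖ * _
  set d := a - (x + c) with hd
  have hdn : 0 ≤ ‖d‖ := norm_nonneg d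
  have e : a = x + c + d := by rw [hd]; abel
  have hna : ‖a‖ ≤ ‖x‖ + ‖c‖ + ‖d‖ := by rw [e]; exact norm_add₃_le
  have hfa : f a = f x + f c + f d := by rw [e, map_add, map_add]
  have hfd : -(‖f‖ * ‖d‖) ≤ f d := (abs_le.mp (f.le_opNorm d)).1
  have k1 : α * ‖a‖ * ‖f‖ ≤ α * (‖x‖ + ‖c‖ + ‖d‖) * ‖f‖ := by gcongr
  have k2 : α * (‖d‖ * ‖f‖) ≤ 1 * (‖d‖ * ‖f‖) := by gcongr
  nlinarith
end

section
/- Let X be a real Banach space and let E ⊆ X and D ⊆ X* be norm-dense subsets. Let A ⊆ X, x ∈ X and α ∈ [0,1). Then A is α-cone porous at x if and only if: there exists a positive rational R such that for every positive rational ε there exist y* ∈ D with y* ≠ 0 and w ∈ U(x,ε) ∩ E such that U(x,R) ∩ (w + C(y*,α)) ∩ A = ∅. -/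
open Set Metric Filter Topology

/-- Equivalent definition of α-cone porosity at a point using norm-dense subsets
`E ⊆ X` and `D ⊆ X*` and rational radii. -/
theorem conePorousAt_iff_dense
    {X : Type*} [NormedAddCommGroup X] [NormedSpace ℝ X] [CompleteSpace X]
    (E : Set X) (hE : Dense E) (D : Set (X →L[ℝ] ℝ)) (hD : Dense D)
    (A : Set X) (x : X) (α : ℝ) (hα : α ∈ Set.Ico (0 : ℝ) 1) :
    ConePorousAt α A x ↔
      ∃ R : ℚ, 0 < R ∧ ∀ ε : ℚ, 0 < ε →
        ∃ f ∈ D, f ≠ 0 ∧ ∃ w ∈ Metric.ball x (ε : ℝ) ∩ E,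
          Metric.ball x (R : ℝ) ∩ ((w + ·) '' ConeSet f α) ∩ A = ∅ := by
  obtain ⟨hα0, hα1⟩ := hα
  constructor
  · rintro ⟨R, hR, H⟩
    obtain ⟨R', hR'0, hR'⟩ := exists_rat_btwn hR
    refine ⟨R', by exact_mod_cast hR'0, fun ε hε => ?_⟩
    have hε' : (0 : ℝ) < ε := by exact_mod_cast hε
    obtain ⟨z, hz, f, hf, hem⟩ := H (ε / 2) (by positivity)
    have hfn : 0 < ‖f‖ := norm_pos_iff.2 hf
    obtain ⟨v, hv⟩ : ∃ v, α * ‖v‖ * ‖f‖ < f v := by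
      by_contra! hcon
      have : ‖f‖ ≤ α * ‖f‖ := by
        refine f.opNorm_le_bound (by positivity) fun v => ?_
        rw [Real.norm_eq_abs, abs_le]
        have h1 := hcon v
        have h2 := hcon (-v)
        rw [norm_neg, map_neg] at h2
        constructor <;> nlinarith
      nlinarith
    set t : ℝ := ε / 2 / (‖v‖ + 1) with ht
    have ht0 : 0 < t := by positivity
    have htv : t * ‖v‖ < ε / 2 := by
      have : t * (‖v‖ + 1) = ε / 2 := by rw [ht]; field_simp
      nlinarith
    have hopen : IsOpen (Metric.ball x (ε : ℝ) ∩ {w | α * ‖w - z‖ * ‖f‖ < f (w - z)}) := by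
      refine Metric.isOpen_ball.inter (isOpen_lt ?_ ?_) <;> fun_prop
    obtain ⟨w, ⟨hw1, hw2⟩, hwE⟩ := hE.inter_open_nonempty _ hopen ⟨z + t • v, by
      rw [Metric.mem_ball, dist_eq_norm] at hz ⊢
      have : z + t • v - x = (z - x) + t • v := by abel
      rw [this]
      have h2 := norm_add_le (z - x) (t • v)
      rw [norm_smul, Real.norm_eq_abs, abs_of_pos ht0] at h2
      linarith, by
      simp only [mem_setOf_eq, add_sub_cancel_left, norm_smul, Real.norm_eq_abs, abs_of_pos ht0,
        map_smul, smul_eq_mul]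
      nlinarith⟩
    simp only [mem_setOf_eq] at hw2
    set δ := f (w - z) - α * ‖w - z‖ * ‖f‖ with hδ
    have hδ0 : 0 < δ := by linarith
    have hM : (0 : ℝ) < R + ε := by positivity
    obtain ⟨g, hgD, hg⟩ := hD.exists_dist_lt f
      (ε := min ‖f‖ (δ / (2 * (R + ε)))) (lt_min hfn (by positivity))
    rw [dist_eq_norm, lt_min_iff] at hg
    obtain ⟨hg1, hg2⟩ := hg
    rw [lt_div_iff₀ (by positivity)] at hg2
    refine ⟨g, hgD, ?_, w, ⟨hw1, hwE⟩, ?_⟩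
    · rintro rfl
      simp at hg1
    rw [Set.eq_empty_iff_forall_notMem]
    rintro y ⟨⟨hyR, u, hu, rfl⟩, hyA⟩
    rw [Set.eq_empty_iff_forall_notMem] at hem
    refine hem (w + u) ⟨⟨Metric.ball_subset_ball hR'.le hyR, u + (w - z), ?_, ?_⟩, hyA⟩
    · simp only [ConeSet, mem_setOf_eq] at hu ⊢
      rw [Metric.mem_ball, dist_eq_norm] at hw1
      have hyR2 : ‖w + u - x‖ < R' := by simpa [Metric.mem_ball, dist_eq_norm] using hyR
      have huM : ‖u‖ ≤ R + ε := by
        have h := norm_sub_le (w + u - x) (w - x)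
        have e : w + u - x - (w - x) = u := by abel
        rw [e] at h
        linarith
      have h1 : |(f - g) u| ≤ ‖f - g‖ * ‖u‖ := (f - g).le_opNorm u
      rw [ContinuousLinearMap.sub_apply] at h1
      have h2 := (abs_le.1 h1).1
      have h3 : ‖f‖ ≤ ‖g‖ + ‖f - g‖ := by
        have := norm_add_le g (f - g)
        rwa [add_sub_cancel] at this
      have h4 : ‖f - g‖ * ‖u‖ ≤ ‖f - g‖ * (R + ε) := by gcongr
      have h5 : α * ‖u‖ * ‖f‖ ≤ α * ‖u‖ * (‖g‖ + ‖f - g‖) := by gcongr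
      have h6 : α * (‖f - g‖ * ‖u‖) ≤ 1 * (‖f - g‖ * ‖u‖) := by gcongr
      have h7 : α * ‖u + (w - z)‖ * ‖f‖ ≤ α * (‖u‖ + ‖w - z‖) * ‖f‖ := by
        gcongr; exact norm_add_le _ _
      rw [map_add]
      nlinarith
    · simp only; abel
  · rintro ⟨R, hR, H⟩
    refine ⟨R, by exact_mod_cast hR, fun ε hε => ?_⟩
    obtain ⟨q, hq0, hq⟩ := exists_rat_btwn hε
    obtain ⟨f, -, hf, w, ⟨hw, -⟩, h⟩ := H q (by exact_mod_cast hq0)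
    exact ⟨w, Metric.ball_subset_ball hq.le hw, f, hf, h⟩
end

section
/- Let X be a real Banach space, α ∈ [0,1), and A ⊆ X an arbitrary set. Then the set S of all points x ∈ X at which A is α-cone porous is a Borel set of type G_δσ, i.e. a countable union of countable intersections of open subsets of X. -/
open Set Metric Filter Topology

/-- For a real Banach space `X`, `α ∈ [0,1)` and an arbitrary set `A ⊆ X`, the set of
points at which `A` is α-cone porous is a `G_δσ` set, i.e. a countable union of
countable intersections of open sets. -/
theorem conePorousAt_points_Gdeltasigma
    {X : Type*} [NormedAddCommGroup X] [NormedSpace ℝ X] [CompleteSpace X]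
    (α : ℝ) (hα : α ∈ Set.Ico (0 : ℝ) 1) (A : Set X) :
    ∃ U : ℕ → ℕ → Set X, (∀ n m, IsOpen (U n m)) ∧
      {x : X | ConePorousAt α A x} = ⋃ n, ⋂ m, U n m := by
  refine ⟨fun n m => {x | ∃ r > 1 / ((n : ℝ) + 1), ∃ z ∈ Metric.ball x (1 / ((m : ℝ) + 1)),
    ∃ f : X →L[ℝ] ℝ, f ≠ 0 ∧ Metric.ball x r ∩ ((z + ·) '' ConeSet f α) ∩ A = ∅}, ?_, ?_⟩
  · intro n m
    rw [Metric.isOpen_iff]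
    rintro x ⟨r, hr, z, hz, f, hf, h⟩
    rw [Metric.mem_ball] at hz
    refine ⟨min ((r - 1 / ((n : ℝ) + 1)) / 2) (1 / ((m : ℝ) + 1) - dist z x),
      lt_min (by linarith) (by linarith), ?_⟩
    intro y hy
    rw [Metric.mem_ball, lt_min_iff] at hy
    obtain ⟨h1, h2⟩ := hy
    refine ⟨r - dist y x, by linarith, z, ?_, f, hf, ?_⟩
    · rw [Metric.mem_ball]
      have := dist_triangle z x y
      rw [dist_comm x y] at this
      linarith
    · refine Set.subset_eq_empty ?_ h
      refine Set.inter_subset_inter_left _ (Set.inter_subset_inter_left _ ?_)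
      exact Metric.ball_subset_ball' (by linarith)
  · ext x
    simp only [Set.mem_setOf_eq, Set.mem_iUnion, Set.mem_iInter]
    constructor
    · rintro ⟨R, hR, h⟩
      obtain ⟨n, hn⟩ := exists_nat_one_div_lt hR
      exact ⟨n, fun m => ⟨R, hn, h _ Nat.one_div_pos_of_nat⟩⟩
    · rintro ⟨n, h⟩
      refine ⟨1 / ((n : ℝ) + 1), Nat.one_div_pos_of_nat, fun ε hε => ?_⟩
      obtain ⟨m, hm⟩ := exists_nat_one_div_lt hε
      obtain ⟨r, hr, z, hz, f, hf, h⟩ := h m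
      refine ⟨z, Metric.ball_subset_ball hm.le hz, f, hf, Set.subset_eq_empty ?_ h⟩
      refine Set.inter_subset_inter_left _ (Set.inter_subset_inter_left _ ?_)
      exact Metric.ball_subset_ball (le_of_lt hr)
end

section
/- Let X be a real Banach space, α ∈ [0,1), and A ⊆ X a Suslin set. Then the set N(A) = {x ∈ A : A is not α-cone porous at x} is a Suslin set. -/
open Set Metric Filter Topology

theorem suslin_inter_aux {X : Type*} [TopologicalSpace X] (A : Set X) (hA : IsSuslin A)
    (F : ℕ → ℕ → Set X) (hF : ∀ n m, IsClosed (F n m)) :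
    IsSuslin (A ∩ ⋂ n, ⋃ m, F n m) := by
  obtain ⟨S, hS, rfl⟩ := hA
  refine ⟨fun s => S (s.map fun k => k.unpair.1) ∩
    ⋂ k : ℕ, ⋂ h : k < s.length, F k (s[k]).unpair.2, ?_, ?_⟩
  · intro s
    exact (hS _).inter (isClosed_iInter fun k => isClosed_iInter fun h => hF _ _)
  · ext x
    simp only [SuslinOp, seg, mem_iUnion, mem_iInter, mem_inter_iff, List.map_map,
      List.length_map, List.length_range, List.getElem_map, List.getElem_range]
    constructor
    · rintro ⟨ν, h⟩
      refine ⟨⟨_, fun n => (h n).1⟩, fun n => ⟨_, (h (n+1)).2 n (Nat.lt_succ_self n)⟩⟩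
    · rintro ⟨⟨a, ha⟩, hb⟩
      choose b hb using hb
      refine ⟨fun k => Nat.pair (a k) (b k), fun n => ⟨?_, fun k _ => ?_⟩⟩
      · have : ((fun k : ℕ => k.unpair.1) ∘ fun k => Nat.pair (a k) (b k)) = a := by
          funext k; simp
        rw [this]; exact ha n
      · simpa using hb k

/-- Uniform non-porosity set. -/
def GSet {X : Type*} [NormedAddCommGroup X] [NormedSpace ℝ X]
    (α : ℝ) (A : Set X) (R ε : ℝ) : Set X :=
  {x | ∀ z ∈ Metric.ball x ε, ∀ f : X →L[ℝ] ℝ, f ≠ 0 →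
    (Metric.ball x R ∩ ((z + ·) '' ConeSet f α) ∩ A).Nonempty}

theorem closure_GSet {X : Type*} [NormedAddCommGroup X] [NormedSpace ℝ X]
    (α : ℝ) (A : Set X) (R R' ε : ℝ) (h : R < R') (hε : 0 < ε) :
    closure (GSet α A R ε) ⊆ GSet α A R' ε := by
  intro x hx z hz f hf
  rw [Metric.mem_ball] at hz
  obtain ⟨y, hy, hxy⟩ := Metric.mem_closure_iff.1 hx (min (R' - R) (ε - dist z x))
    (lt_min (by linarith) (by linarith))
  have h1 := lt_of_lt_of_le hxy (min_le_left _ _)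
  have h2 := lt_of_lt_of_le hxy (min_le_right _ _)
  obtain ⟨a, ⟨ha, hc⟩, haA⟩ := hy z (by
    rw [Metric.mem_ball]
    linarith [dist_triangle z x y]) f hf
  refine ⟨a, ⟨?_, hc⟩, haA⟩
  rw [Metric.mem_ball] at ha ⊢
  linarith [dist_triangle a y x, dist_comm x y]

/-- For a real Banach space `X`, `α ∈ [0,1)` and a Suslin set `A ⊆ X`, the set
`N(A) = {x ∈ A : A is not α-cone porous at x}` is Suslin. -/
theorem NP_cone_suslin
    {X : Type*} [NormedAddCommGroup X] [NormedSpace ℝ X] [CompleteSpace X]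
    (α : ℝ) (hα : α ∈ Set.Ico (0 : ℝ) 1) (A : Set X) (hA : IsSuslin A) :
    IsSuslin {x ∈ A | ¬ ConePorousAt α A x} := by
  have key : {x ∈ A | ¬ ConePorousAt α A x} =
      A ∩ ⋂ n : ℕ, ⋃ m : ℕ, closure (GSet α A (1 / ((n : ℝ) + 1)) (1 / ((m : ℝ) + 1))) := by
    ext x
    simp only [mem_setOf_eq, mem_inter_iff, mem_iInter, mem_iUnion]
    refine and_congr_right fun _ => ?_
    unfold ConePorousAt
    push Not
    constructor
    · intro h n
      obtain ⟨ε, hε, h⟩ := h (1 / ((n : ℝ) + 1)) (by positivity)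
      obtain ⟨m, hm⟩ := exists_nat_one_div_lt hε
      exact ⟨m, subset_closure fun z hz f hf => h z (Metric.ball_subset_ball hm.le hz) f hf⟩
    · intro h R hR
      obtain ⟨n, hn⟩ := exists_nat_one_div_lt hR
      obtain ⟨m, hm⟩ := h n
      have hp : (0 : ℝ) < 1 / ((m : ℝ) + 1) := by positivity
      exact ⟨_, hp, closure_GSet α A _ R _ hn hp hm⟩
  rw [key]
  exact suslin_inter_aux A hA _ fun _ _ => isClosed_closure
end

section
/- Let X and Y be real Banach spaces, G ⊆ X an open set, and f : G → Y an arbitrary mapping. Then for every separable linear subspace V0 ⊆ X there exists a closed separable linear subspace V ⊆ X with V0 ⊆ V such that the following are equivalent: (i) the set of all points of G where f is not Fréchet differentiable is cone small in X; (ii) the set of all points of V ∩ G where the restriction of f to V ∩ G (viewed as a mapping on the Banach space V) is not Fréchet differentiable is cone small in V. -/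
open Set Metric Filter Topology

theorem mem_shift {E : Type*} [NormedAddCommGroup E] [NormedSpace ℝ E]
    (f : E →L[ℝ] ℝ) (α : ℝ) (z y : E) :
    y ∈ ((z + ·) '' ConeSet f α) ↔ α * ‖y - z‖ * ‖f‖ < f (y - z) := by
  constructor
  · rintro ⟨x, hx, rfl⟩
    simpa [ConeSet] using hx
  · intro h
    exact ⟨y - z, h, by simp⟩

theorem porousAt_iff {E : Type*} [NormedAddCommGroup E] [NormedSpace ℝ E]
    (α : ℝ) (A : Set E) (x : E) :
    ConePorousAt α A x ↔ ∃ R > (0 : ℝ), ∀ ε > (0 : ℝ), ∃ z ∈ ball x ε, ∃ f : E →L[ℝ] ℝ, f ≠ 0 ∧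
      ∀ y ∈ ball x R, y ∈ A → f (y - z) ≤ α * ‖y - z‖ * ‖f‖ := by
  unfold ConePorousAt
  have key : ∀ (R : ℝ) (z : E) (f : E →L[ℝ] ℝ),
      ball x R ∩ ((z + ·) '' ConeSet f α) ∩ A = ∅ ↔
      ∀ y ∈ ball x R, y ∈ A → f (y - z) ≤ α * ‖y - z‖ * ‖f‖ := by
    intro R z f
    rw [Set.eq_empty_iff_forall_notMem]
    constructor
    · intro h y hy hA
      by_contra hlt
      exact h y ⟨⟨hy, (mem_shift f α z y).2 (not_le.1 hlt)⟩, hA⟩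
    · rintro h y ⟨⟨hy, hc⟩, hA⟩
      exact absurd (h y hy hA) (not_le.2 ((mem_shift f α z y).1 hc))
  simp only [key]

theorem porous_mono {E : Type*} [NormedAddCommGroup E] [NormedSpace ℝ E]
    {α β : ℝ} (hαβ : α ≤ β) {A B : Set E} (hBA : B ⊆ A) (h : ConePorous α A) :
    ConePorous β B := by
  intro x hx
  obtain ⟨R, hR, h⟩ := (porousAt_iff α A x).1 (h x (hBA hx))
  refine (porousAt_iff β B x).2 ⟨R, hR, fun ε hε => ?_⟩
  obtain ⟨z, hz, f, hf, h⟩ := h ε hε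
  refine ⟨z, hz, f, hf, fun y hy hyB => (h y hy (hBA hyB)).trans ?_⟩
  gcongr

theorem sigma_of_subset {E : Type*} [NormedAddCommGroup E] [NormedSpace ℝ E]
    {α : ℝ} {A : Set E} {ι : Type*} [Countable ι] (g : ι → Set E)
    (hg : ∀ i, ConePorous α (g i)) (hA : A ⊆ ⋃ i, g i) : SigmaConePorous α A := by
  rcases isEmpty_or_nonempty ι with hι | hι
  · refine ⟨fun _ => ∅, fun _ x hx => absurd hx (by simp), ?_⟩
    have : A = ∅ := by
      apply Set.eq_empty_of_subset_empty
      simpa using hA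
    simp [this]
  · obtain ⟨e, he⟩ := exists_surjective_nat ι
    refine ⟨fun n => A ∩ g (e n), fun n => porous_mono le_rfl Set.inter_subset_right (hg _), ?_⟩
    rw [← Set.inter_iUnion]
    refine (Set.inter_eq_left.2 (hA.trans ?_)).symm
    rw [he.iUnion_comp g]

theorem sigma_mono {E : Type*} [NormedAddCommGroup E] [NormedSpace ℝ E]
    {α β : ℝ} (hαβ : α ≤ β) {A B : Set E} (hBA : B ⊆ A) (h : SigmaConePorous α A) :
    SigmaConePorous β B := by
  obtain ⟨g, hg, rfl⟩ := h
  exact sigma_of_subset g (fun i => porous_mono hαβ le_rfl (hg i)) hBA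

theorem sigma_iUnion {E : Type*} [NormedAddCommGroup E] [NormedSpace ℝ E]
    {α : ℝ} {ι : Type*} [Countable ι] (A : ι → Set E) (h : ∀ i, SigmaConePorous α (A i)) :
    SigmaConePorous α (⋃ i, A i) := by
  choose g hg hA using h
  refine sigma_of_subset (fun p : ι × ℕ => g p.1 p.2) (fun p => hg _ _) ?_
  intro x hx
  obtain ⟨i, hi⟩ := Set.mem_iUnion.1 hx
  rw [hA i] at hi
  obtain ⟨n, hn⟩ := Set.mem_iUnion.1 hi
  exact Set.mem_iUnion.2 ⟨(i, n), hn⟩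

theorem sigma_union {E : Type*} [NormedAddCommGroup E] [NormedSpace ℝ E]
    {α : ℝ} {A B : Set E} (hA : SigmaConePorous α A) (hB : SigmaConePorous α B) :
    SigmaConePorous α (A ∪ B) := by
  rw [Set.union_eq_iUnion]
  exact sigma_iUnion _ (by intro b; cases b <;> assumption)

/-- Locally σ-porous sets are σ-porous. -/
theorem sigma_local_s17 {E : Type*} [NormedAddCommGroup E] [NormedSpace ℝ E]
    {α : ℝ} (A B : Set E)
    (h : ∀ x ∈ A, ∃ r > (0 : ℝ), SigmaConePorous α (B ∩ ball x r)) (hAB : A ⊆ B) :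
    SigmaConePorous α A := by
  choose! r hr hs using h
  obtain ⟨lo, wf⟩ := exists_wellFoundedLT E
  have hmin : ∀ y ∈ A, ∃ i ∈ A, y ∈ ball i (r i) ∧ ∀ j ∈ A, y ∈ ball j (r j) → i ≤ j := by
    intro y hy
    obtain ⟨i, hi, hmin⟩ := WellFounded.has_min (wellFounded_lt (α := E))
      {i | i ∈ A ∧ y ∈ ball i (r i)} ⟨y, hy, mem_ball_self (hr y hy)⟩
    exact ⟨i, hi.1, hi.2, fun j hj hyj => not_lt.1 (hmin j ⟨hj, hyj⟩)⟩
  choose! i hiA hi hle using hmin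
  unfold SigmaConePorous at hs
  choose! g hg hG using hs
  let Q : ℕ × ℕ → Set E := fun p =>
    {y | y ∈ A ∧ y ∈ g (i y) p.1 ∧ ball y (1 / ((p.2 : ℝ) + 1)) ⊆ ball (i y) (r (i y))}
  refine sigma_of_subset Q ?_ ?_
  · rintro ⟨n, m⟩ y ⟨hyA, hyg, hyb⟩
    obtain ⟨R, hR, hp⟩ := (porousAt_iff _ _ _).1 (hg (i y) (hiA y hyA) n y hyg)
    have hm : (0 : ℝ) < 1 / ((m : ℝ) + 1) := by positivity
    refine (porousAt_iff _ _ _).2 ⟨min R (1 / ((m : ℝ) + 1)), lt_min hR hm, fun ε hε => ?_⟩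
    obtain ⟨z, hz, f, hf, hp⟩ := hp ε hε
    refine ⟨z, hz, f, hf, ?_⟩
    rintro y' hy' ⟨hyA', hyg', hyb'⟩
    have h1 : y' ∈ ball y (1 / ((m : ℝ) + 1)) := ball_subset_ball (min_le_right _ _) hy'
    have h2 : i y' ≤ i y := hle y' hyA' _ (hiA y hyA) (hyb h1)
    have h3 : i y ≤ i y' := hle y hyA _ (hiA y' hyA') (hyb' (mem_ball_comm.1 h1))
    have h4 : i y' = i y := le_antisymm h2 h3
    rw [h4] at hyg'
    exact hp y' (ball_subset_ball (min_le_left _ _) hy') hyg'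
  · intro y hy
    have h1 : y ∈ B ∩ ball (i y) (r (i y)) := ⟨hAB hy, hi y hy⟩
    rw [hG (i y) (hiA y hy)] at h1
    obtain ⟨n, hn⟩ := Set.mem_iUnion.1 h1
    obtain ⟨ε, hε, hb⟩ := Metric.isOpen_iff.1 isOpen_ball y (hi y hy)
    obtain ⟨m, hm⟩ := exists_nat_one_div_lt hε
    exact Set.mem_iUnion.2 ⟨(n, m), hy, hn, (ball_subset_ball hm.le).trans hb⟩

/-- The kernel. -/
theorem exists_kernel {E : Type*} [NormedAddCommGroup E] [NormedSpace ℝ E]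
    {α : ℝ} (B : Set E) (hB : IsGδ B) (hn : ¬ SigmaConePorous α B) :
    ∃ K ⊆ B, IsGδ K ∧ K.Nonempty ∧ ∀ d r, (K ∩ ball d r).Nonempty →
      ∃ x ∈ K ∩ ball d r, ∃ ε > (0 : ℝ), ∀ z ∈ ball x ε, ∀ f : E →L[ℝ] ℝ, f ≠ 0 →
        ∃ s ∈ K ∩ ball d r, α * ‖s - z‖ * ‖f‖ < f (s - z) := by
  let O : Set E := {x | ∃ r > (0 : ℝ), SigmaConePorous α (B ∩ ball x r)}
  have hO : IsOpen O := by
    rw [Metric.isOpen_iff]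
    rintro x ⟨r, hr, h⟩
    refine ⟨r / 2, by positivity, fun y hy => ⟨r / 2, by positivity, sigma_mono le_rfl ?_ h⟩⟩
    refine Set.inter_subset_inter_right _ (ball_subset_ball' ?_)
    rw [mem_ball] at hy
    linarith
  have hσ : SigmaConePorous α (B ∩ O) :=
    sigma_local_s17 _ B (fun x hx => hx.2) Set.inter_subset_left
  have hK : ∀ d r, ((B ∩ Oᶜ) ∩ ball d r).Nonempty → ¬ SigmaConePorous α ((B ∩ Oᶜ) ∩ ball d r) := by
    rintro d r ⟨x, ⟨hxB, hxO⟩, hx⟩ hc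
    obtain ⟨ε, hε, hb⟩ := Metric.isOpen_iff.1 isOpen_ball x hx
    apply hxO
    refine ⟨ε, hε, sigma_mono le_rfl ?_ (sigma_union hc hσ)⟩
    rintro y ⟨hyB, hy⟩
    by_cases hyO : y ∈ O
    · exact Or.inr ⟨hyB, hyO⟩
    · exact Or.inl ⟨⟨hyB, hyO⟩, hb hy⟩
  refine ⟨B ∩ Oᶜ, Set.inter_subset_left, hB.inter hO.isClosed_compl.isGδ, ?_, ?_⟩
  · by_contra hne
    apply hn
    refine sigma_mono le_rfl ?_ hσ
    intro x hx
    by_contra hxO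
    exact hne ⟨x, hx, fun h => hxO ⟨hx, h⟩⟩
  · intro d r hne
    by_contra hcon
    push Not at hcon
    refine hK d r hne (sigma_of_subset (fun _ : Unit => (B ∩ Oᶜ) ∩ ball d r) (fun _ x hx => ?_)
      (fun x hx => Set.mem_iUnion.2 ⟨(), hx⟩))
    refine (porousAt_iff _ _ _).2 ⟨1, one_pos, fun ε hε => ?_⟩
    obtain ⟨z, hz, f, hf, h⟩ := hcon x hx ε hε
    exact ⟨z, hz, f, hf, fun y _ hy => h y hy⟩

theorem exists_closed_off {X : Type*} (op : X → X → X → Set X)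
    (hop : ∀ a b c, (op a b c).Countable) (D₀ : Set X) (hD₀ : D₀.Countable) :
    ∃ D : Set X, D.Countable ∧ D₀ ⊆ D ∧ ∀ a ∈ D, ∀ b ∈ D, ∀ c ∈ D, op a b c ⊆ D := by
  let S : ℕ → Set X := fun n => Nat.rec D₀
    (fun _ D => D ∪ ⋃ a ∈ D, ⋃ b ∈ D, ⋃ c ∈ D, op a b c) n
  have hS : ∀ n, S (n + 1) = S n ∪ ⋃ a ∈ S n, ⋃ b ∈ S n, ⋃ c ∈ S n, op a b c := fun n => rfl
  have hc : ∀ n, (S n).Countable := by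
    intro n
    induction n with
    | zero => exact hD₀
    | succ n ih =>
      rw [hS]
      exact ih.union (ih.biUnion fun a _ => ih.biUnion fun b _ => ih.biUnion fun c _ => hop a b c)
  have hm : Monotone S := monotone_nat_of_le_succ fun n => by
    rw [hS]; exact Set.subset_union_left
  refine ⟨⋃ n, S n, Set.countable_iUnion hc, Set.subset_iUnion S 0, ?_⟩
  intro a ha b hb c hc
  obtain ⟨i, hi⟩ := Set.mem_iUnion.1 ha
  obtain ⟨j, hj⟩ := Set.mem_iUnion.1 hb
  obtain ⟨k, hk⟩ := Set.mem_iUnion.1 hc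
  let n := max i (max j k)
  refine Set.Subset.trans ?_ (Set.subset_iUnion S (n + 1))
  rw [hS]
  refine Set.Subset.trans ?_ Set.subset_union_right
  intro x hx
  simp only [Set.mem_iUnion]
  exact ⟨a, hm (le_max_left _ _) hi, b, hm ((le_max_left _ _).trans (le_max_right _ _)) hj,
    c, hm ((le_max_right _ _).trans (le_max_right _ _)) hk, hx⟩

/-- Closing off to a closed separable subspace with a countable dense subset. -/
theorem exists_subspace {X : Type*} [NormedAddCommGroup X] [NormedSpace ℝ X]
    (op : X → X → X → Set X) (hop : ∀ a b c, (op a b c).Countable)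
    (V₀ : Subspace ℝ X) (hV₀ : TopologicalSpace.SeparableSpace V₀) :
    ∃ (V : Subspace ℝ X) (D : Set X), IsClosed (V : Set X) ∧ TopologicalSpace.SeparableSpace V ∧
      V₀ ≤ V ∧ (V : Set X) = closure D ∧ D.Nonempty ∧
      ∀ a ∈ D, ∀ b ∈ D, ∀ c ∈ D, op a b c ⊆ D := by
  obtain ⟨s, hsc, hsd⟩ := TopologicalSpace.exists_countable_dense V₀
  obtain ⟨D, hDc, hD₀, hD⟩ := exists_closed_off
    (fun a b c => op a b c ∪ Set.range (fun p : ℚ × ℚ => (p.1 : ℝ) • a + (p.2 : ℝ) • b))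
    (fun a b c => (hop a b c).union (Set.countable_range _))
    (insert 0 ((fun x : V₀ => (x : X)) '' s)) ((hsc.image _).insert 0)
  have h0 : (0 : X) ∈ D := hD₀ (Set.mem_insert _ _)
  have hcomb : ∀ a ∈ D, ∀ b ∈ D, ∀ p q : ℚ, (p : ℝ) • a + (q : ℝ) • b ∈ D := fun a ha b hb p q =>
    hD a ha b hb 0 h0 (Or.inr ⟨(p, q), rfl⟩)
  let V : Subspace ℝ X :=
    { carrier := closure D
      zero_mem' := subset_closure h0
      add_mem' := fun {a b} ha hb => map_mem_closure₂ continuous_add ha hb (fun a ha b hb => by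
        simpa using hcomb a ha b hb 1 1)
      smul_mem' := fun c x hx => by
        have hc : c ∈ closure (Set.range ((↑) : ℚ → ℝ)) := Rat.denseRange_cast c
        refine map_mem_closure₂ continuous_smul hc hx ?_
        rintro _ ⟨q, rfl⟩ b hb
        simpa using hcomb b hb b hb q 0 }
  have hV : (V : Set X) = closure D := rfl
  refine ⟨V, D, hV ▸ isClosed_closure, ?_, ?_, hV, ⟨0, h0⟩, ?_⟩
  · have : TopologicalSpace.IsSeparable (V : Set X) := hV ▸ hDc.isSeparable.closure
    exact this.separableSpace
  · intro x hx
    have h1 : (⟨x, hx⟩ : V₀) ∈ closure s := hsd _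
    have h2 := map_mem_closure continuous_subtype_val h1
      (t := D) (fun y hy => hD₀ (Set.mem_insert_of_mem _ ⟨y, hy, rfl⟩))
    exact h2
  · exact fun a ha b hb c hc => Set.subset_union_left.trans (hD a ha b hb c hc)

theorem clm_norm_pos {E : Type*} [NormedAddCommGroup E] [NormedSpace ℝ E]
    (f : E →L[ℝ] ℝ) (hf : f ≠ 0) : 0 < ‖f‖ := norm_pos_iff.2 hf

theorem finite_witness {E : Type*} [NormedAddCommGroup E] [NormedSpace ℝ E]
    (S : Set E) (z u : E) (β : ℝ)
    (h : ∀ f : E →L[ℝ] ℝ, ‖f‖ ≤ 1 → ‖u‖ / 2 ≤ f u → ∃ s ∈ S, β * ‖s - z‖ < f (s - z)) :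
    ∃ F : Set E, F.Finite ∧ F ⊆ S ∧
      ∀ f : E →L[ℝ] ℝ, ‖f‖ ≤ 1 → ‖u‖ / 2 ≤ f u → ∃ s ∈ F, β * ‖s - z‖ < f (s - z) := by
  have hcomp := WeakDual.isCompact_closedBall (𝕜 := ℝ) (E := E) 0 1
  have hcl : IsClosed {f : WeakDual ℝ E | ‖u‖ / 2 ≤ f u} :=
    isClosed_le continuous_const (WeakDual.eval_continuous u)
  obtain ⟨F, hFS, hF, hcov⟩ := (hcomp.inter_right hcl).elim_finite_subcover_image (b := S)
    (c := fun s => {f : WeakDual ℝ E | β * ‖s - z‖ < f (s - z)})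
    (fun s _ => isOpen_lt continuous_const (WeakDual.eval_continuous (s - z))) (by
      rintro f ⟨hf1, hf2⟩
      obtain ⟨s, hs, hlt⟩ := h (WeakDual.toStrongDual f) (by simpa using hf1) hf2
      exact Set.mem_biUnion hs hlt)
  refine ⟨F, hF, hFS, fun f hf1 hf2 => ?_⟩
  have := @hcov (StrongDual.toWeakDual f) ⟨by simpa using hf1, hf2⟩
  simp only [Set.mem_iUnion] at this
  obtain ⟨s, hs, hlt⟩ := this
  exact ⟨s, hs, hlt⟩

theorem exists_half_norm {E : Type*} [NormedAddCommGroup E] [NormedSpace ℝ E]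
    (f : E →L[ℝ] ℝ) (hf : f ≠ 0) (c : ℝ) (hc : c < 1) :
    ∃ u, c * ‖u‖ * ‖f‖ < f u := by
  have hpos : 0 < ‖f‖ := norm_pos_iff.2 hf
  by_contra! hcon
  have h0 : 0 ≤ c := by
    by_contra! hneg
    obtain ⟨u, hu⟩ : ∃ u, f u ≠ 0 := by
      by_contra! h
      exact hf (ContinuousLinearMap.ext h)
    have hun : 0 < ‖u‖ := norm_pos_iff.2 (by rintro rfl; simp at hu)
    have h1 := hcon u
    have h2 := hcon (-u)
    simp only [norm_neg, map_neg] at h2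
    have : c * ‖u‖ * ‖f‖ < 0 := by
      have := mul_pos hun hpos
      nlinarith
    linarith
  have : ‖f‖ ≤ c * ‖f‖ := by
    refine f.opNorm_le_bound (by positivity) fun x => ?_
    rw [Real.norm_eq_abs, abs_le]
    have h1 := hcon x
    have h2 := hcon (-x)
    simp only [norm_neg, map_neg] at h2
    constructor <;> nlinarith
  nlinarith

theorem cone_smul_small {E : Type*} [NormedAddCommGroup E] [NormedSpace ℝ E]
    (f : E →L[ℝ] ℝ) (hf : f ≠ 0) (c : ℝ) (hc : c < 1) (η : ℝ) (hη : 0 < η) :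
    ∃ u, ‖u‖ < η ∧ c * ‖u‖ * ‖f‖ < f u := by
  obtain ⟨u, hu⟩ := exists_half_norm f hf c hc
  have ht : 0 < η / (‖u‖ + 1) := by positivity
  refine ⟨(η / (‖u‖ + 1)) • u, ?_, ?_⟩
  · rw [norm_smul, Real.norm_of_nonneg ht.le, div_mul_eq_mul_div, div_lt_iff₀ (by positivity)]
    nlinarith
  · rw [norm_smul, Real.norm_of_nonneg ht.le, map_smul, smul_eq_mul]
    have := mul_lt_mul_of_pos_left hu ht
    linarith

theorem core {X : Type*} [NormedAddCommGroup X] [NormedSpace ℝ X] [CompleteSpace X]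
    (V₀ : Subspace ℝ X) (hV₀ : TopologicalSpace.SeparableSpace V₀)
    {α : ℝ} (hα : α ∈ Ioo (0 : ℝ) 1) (B : Set X) (hB : IsGδ B) (hn : ¬ SigmaConePorous α B)
    (c : X → Set X) (hc : ∀ x, (c x).Countable) :
    ∃ V : Subspace ℝ X, IsClosed (V : Set X) ∧ TopologicalSpace.SeparableSpace V ∧ V₀ ≤ V ∧
      ∀ S : Set V, IsGδ S → (∀ x : V, (x : X) ∈ B → c x ⊆ V → x ∈ S) →
        ¬ SigmaConePorous (α / 2) S := by
  obtain ⟨K, hKB, hKG, ⟨k₀, hk₀⟩, hK⟩ := exists_kernel B hB hn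
  choose! x hx ε hε hw using hK
  have hF : ∀ (d : X) (r : ℝ) (z u : X), ∃ F : Set X, F.Finite ∧
      ((K ∩ ball d r).Nonempty → z ∈ ball (x d r) (ε d r) → u ≠ 0 →
        F ⊆ K ∩ ball d r ∧ ∀ f : X →L[ℝ] ℝ, ‖f‖ ≤ 1 → ‖u‖ / 2 ≤ f u →
          ∃ s ∈ F, α / 2 * ‖s - z‖ < f (s - z)) := by
    intro d r z u
    by_cases h : (K ∩ ball d r).Nonempty ∧ z ∈ ball (x d r) (ε d r) ∧ u ≠ 0
    · obtain ⟨F, h1, h2, h3⟩ := finite_witness (K ∩ ball d r) z u (α / 2) (by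
        intro f hf1 hfu
        have hun : 0 < ‖u‖ := norm_pos_iff.2 h.2.2
        have hfn : 1 / 2 ≤ ‖f‖ := by
          have := (le_abs_self _).trans (f.le_opNorm u)
          have h3 : (1 / 2) * ‖u‖ ≤ ‖f‖ * ‖u‖ := by linarith
          exact le_of_mul_le_mul_right h3 hun
        have hf0 : f ≠ 0 := by
          rintro rfl
          simp at hfn
          norm_num at hfn
        obtain ⟨s, hs, hlt⟩ := hw d r h.1 z h.2.1 f hf0
        refine ⟨s, hs, lt_of_le_of_lt ?_ hlt⟩
        have : 0 ≤ α * ‖s - z‖ := mul_nonneg hα.1.le (norm_nonneg _)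
        nlinarith)
      exact ⟨F, h1, fun _ _ _ => ⟨h2, h3⟩⟩
    · exact ⟨∅, Set.finite_empty, fun a b c => absurd ⟨a, b, c⟩ h⟩
  choose F hFfin hF using hF
  obtain ⟨V, D, hVc, hVs, hV₀V, hVD, hDne, hD⟩ := exists_subspace
    (fun d z u => c d ∪ ⋃ r : ℚ, ({x d r} ∪ F d r z u))
    (fun d z u => (hc d).union (Set.countable_iUnion fun r =>
      (Set.countable_singleton _).union (hFfin _ _ _ _).countable)) V₀ hV₀
  have hDV : D ⊆ V := hVD ▸ subset_closure
  have hcD : ∀ d ∈ D, c d ⊆ V := fun d hd =>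
    (Set.subset_union_left.trans (hD d hd d hd d hd)).trans hDV
  have hxD : ∀ d ∈ D, ∀ r : ℚ, x d r ∈ D := fun d hd r =>
    hD d hd d hd d hd (Or.inr (Set.mem_iUnion.2 ⟨r, Or.inl rfl⟩))
  have hFD : ∀ d ∈ D, ∀ z ∈ D, ∀ u ∈ D, ∀ r : ℚ, F d r z u ⊆ D := fun d hd z hz u hu r s hs =>
    hD d hd z hz u hu (Or.inr (Set.mem_iUnion.2 ⟨r, Or.inr hs⟩))
  -- density of D in V
  have hdense : ∀ O : Set V, IsOpen O → O.Nonempty → ∃ d : V, d ∈ O ∧ (d : X) ∈ D := by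
    rintro O hO ⟨y, hy⟩
    obtain ⟨O', hO', rfl⟩ := isOpen_induced_iff.1 hO
    have hyc : (y : X) ∈ closure D := by rw [← hVD]; exact y.2
    obtain ⟨d, hdO, hdD⟩ := mem_closure_iff.1 hyc O' hO' hy
    exact ⟨⟨d, hDV hdD⟩, hdO, hdD⟩
  refine ⟨V, hVc, hVs, hV₀V, ?_⟩
  intro S hSG hS hσ
  have : CompleteSpace V := hVc.completeSpace_coe
  -- small balls
  have hsmall : ∀ y : V, ∀ η > (0 : ℝ), ∃ d ∈ D, ∃ r : ℚ, (y : X) ∈ ball d r ∧ (r : ℝ) < η ∧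
      ball d (r : ℝ) ⊆ ball (y : X) η := by
    intro y η hη
    obtain ⟨r, hr0, hrη⟩ := exists_rat_btwn (half_pos hη)
    obtain ⟨d, hd, hdD⟩ := hdense (ball y r) isOpen_ball ⟨y, mem_ball_self (by exact_mod_cast hr0)⟩
    have hdist : dist (d : X) (y : X) < r := hd
    refine ⟨d, hdD, r, by rwa [mem_ball'], by linarith, ball_subset_ball' (by linarith)⟩
  let KV : Set V := {y | (y : X) ∈ K}
  have hKVG : IsGδ KV := hKG.preimage continuous_subtype_val
  let T := S ∩ KV
  have hTG : IsGδ T := hSG.inter hKVG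
  have hDT : ∀ d : V, (d : X) ∈ D → (d : X) ∈ K → d ∈ T := fun d h1 h2 =>
    ⟨hS d (hKB h2) (hcD d h1), h2⟩
  have hKT : KV ⊆ closure T := by
    intro y hy
    rw [Metric.mem_closure_iff]
    intro η hη
    obtain ⟨d, hd, r, hyr, hrη, hb⟩ := hsmall y η hη
    have h1 := hx d r ⟨y, hy, hyr⟩
    refine ⟨⟨x d r, hDV (hxD d hd r)⟩, hDT _ (hxD d hd r) h1.1, ?_⟩
    have := hb h1.2
    rwa [mem_ball'] at this
  have hTne : T.Nonempty := by
    obtain ⟨d, hd⟩ := hDne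
    obtain ⟨n, hn⟩ := exists_nat_gt (dist k₀ d)
    have h1 := hx d ((n : ℚ) : ℝ) ⟨k₀, hk₀, by simpa using hn⟩
    exact ⟨⟨x d ((n : ℚ) : ℝ), hDV (hxD d hd n)⟩, hDT _ (hxD d hd n) h1.1⟩
  obtain ⟨P, hP, hSP⟩ := hσ
  let Q : ℕ × ℕ → Set V := fun p => {y | y ∈ P p.1 ∧ ∀ ε > (0 : ℝ), ∃ z ∈ ball y ε,
    ∃ f : V →L[ℝ] ℝ, f ≠ 0 ∧ ∀ y' ∈ ball y (1 / ((p.2 : ℝ) + 1)), y' ∈ P p.1 →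
      f (y' - z) ≤ α / 2 * ‖y' - z‖ * ‖f‖}
  have hTQ : T ⊆ ⋃ p, Q p := by
    rintro y ⟨hyS, -⟩
    rw [hSP] at hyS
    obtain ⟨n, hn⟩ := Set.mem_iUnion.1 hyS
    obtain ⟨R, hR, h⟩ := (porousAt_iff _ _ _).1 (hP n y hn)
    obtain ⟨m, hm⟩ := exists_nat_one_div_lt hR
    refine Set.mem_iUnion.2 ⟨(n, m), hn, fun ε hε => ?_⟩
    obtain ⟨z, hz, f, hf, h⟩ := h ε hε
    exact ⟨z, hz, f, hf, fun y' hy' => h y' (ball_subset_ball hm.le hy')⟩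
  -- Baire
  obtain ⟨p, O, hO, x₀, hx₀O, hx₀T, hOQ⟩ : ∃ p, ∃ O : Set V, IsOpen O ∧ ∃ x₀ ∈ O, x₀ ∈ T ∧
      O ∩ T ⊆ closure (Q p) := by
    let Z := closure T
    have : CompleteSpace Z := isClosed_closure.completeSpace_coe
    let TZ : Set Z := {y | (y : V) ∈ T}
    have hTZG : IsGδ TZ := hTG.preimage continuous_subtype_val
    have hTZd : Dense TZ := by
      rw [Subtype.dense_iff]
      intro y hy
      refine closure_mono ?_ hy
      intro t ht
      exact ⟨⟨t, subset_closure ht⟩, ht, rfl⟩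
    have hd := hTZG.dense_iUnion_interior_of_closed hTZd
      (f := fun p => {y : Z | (y : V) ∈ closure (Q p)})
      (fun p => isClosed_closure.preimage continuous_subtype_val) (by
        intro y hy
        obtain ⟨p, hp⟩ := Set.mem_iUnion.1 (hTQ hy)
        exact Set.mem_iUnion.2 ⟨p, subset_closure hp⟩)
    obtain ⟨t, ht⟩ := hTne
    have : Nonempty Z := ⟨⟨t, subset_closure ht⟩⟩
    obtain ⟨w, hw⟩ := hd.nonempty
    obtain ⟨p, hp⟩ := Set.mem_iUnion.1 hw
    obtain ⟨y, hy1, hy2⟩ := hTZd.inter_open_nonempty _ isOpen_interior ⟨w, hp⟩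
    obtain ⟨O, hO, hOeq⟩ := isOpen_induced_iff.1 (isOpen_interior
      (s := {y : Z | (y : V) ∈ closure (Q p)}))
    refine ⟨p, O, hO, y, ?_, hy2, ?_⟩
    · rw [← hOeq] at hy1; exact hy1
    · rintro t ⟨htO, htT⟩
      have : (⟨t, subset_closure htT⟩ : Z) ∈ interior {y : Z | (y : V) ∈ closure (Q p)} := by
        rw [← hOeq]; exact htO
      have h2 := interior_subset this
      exact h2
  obtain ⟨n, j⟩ := p
  have hOK : O ∩ KV ⊆ closure (Q (n, j)) := by
    rintro y ⟨hyO, hyK⟩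
    have h1 : y ∈ closure (O ∩ T) := hO.inter_closure ⟨hyO, hKT hyK⟩
    exact closure_minimal hOQ isClosed_closure h1
  have hj : (0 : ℝ) < 1 / ((j : ℝ) + 1) := by positivity
  obtain ⟨ρ, hρ, hρO⟩ := Metric.isOpen_iff.1 hO x₀ hx₀O
  obtain ⟨d, hd, r, hxr, hrη, hb⟩ := hsmall x₀ (min ρ (1 / ((j : ℝ) + 1) / 2))
    (lt_min hρ (half_pos hj))
  have hne : (K ∩ ball d (r : ℝ)).Nonempty := ⟨x₀, hx₀T.2, hxr⟩
  have hdO : ∀ y : V, (y : X) ∈ ball d (r : ℝ) → y ∈ O := fun y hy =>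
    hρO (ball_subset_ball (min_le_left _ _) (hb hy))
  have hrj : (r : ℝ) < 1 / ((j : ℝ) + 1) / 2 := hrη.trans_le (min_le_right _ _)
  let xx : V := ⟨x d r, hDV (hxD d hd r)⟩
  have hxx := hx d r hne
  have hεp := hε d r hne
  have hxxQ : xx ∈ closure (Q (n, j)) := hOK ⟨hdO xx hxx.2, hxx.1⟩
  have hopen : IsOpen {y : V | (y : X) ∈ ball d (r : ℝ)} :=
    isOpen_ball.preimage continuous_subtype_val
  obtain ⟨q, ⟨hq1, hq2⟩, hqQ⟩ := mem_closure_iff.1 hxxQ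
    ({y : V | (y : X) ∈ ball d (r : ℝ)} ∩ ball xx (ε d r / 2))
    (hopen.inter isOpen_ball) ⟨hxx.2, mem_ball_self (half_pos hεp)⟩
  obtain ⟨z, hz, f, hf, hzf⟩ := hqQ.2 (ε d r / 2) (half_pos hεp)
  have hzx : dist z xx < ε d r := by
    rw [mem_ball] at hz hq2
    linarith [dist_triangle z q xx]
  -- the cone at z misses K in the ball
  have hmiss : ∀ y : V, (y : X) ∈ ball d (r : ℝ) → y ∈ KV →
      f (y - z) ≤ α / 2 * ‖y - z‖ * ‖f‖ := by
    intro y hy hyK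
    by_contra! hlt
    have hyP : y ∈ closure (P n) := closure_mono (fun w hw => hw.1) (hOK ⟨hdO y hy, hyK⟩)
    have hop : IsOpen {y : V | α / 2 * ‖y - z‖ * ‖f‖ < f (y - z)} :=
      isOpen_lt (by fun_prop) (by fun_prop)
    obtain ⟨w, ⟨hw1, hw2⟩, hwP⟩ := mem_closure_iff.1 hyP _ (hopen.inter hop) ⟨hy, hlt⟩
    refine absurd (hzf w ?_ hwP) (not_le.2 hw2)
    have h1 : dist (w : X) d < r := hw1
    have h2 : dist (q : X) d < r := hq1
    have h3 := dist_triangle_right (w : X) q d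
    show dist (w : X) q < 1 / ((j : ℝ) + 1)
    linarith
  have hα2 : α / 2 < 1 := by linarith [hα.2]
  have hα0 : 0 < α / 2 := by linarith [hα.1]
  have hfpos : 0 < ‖f‖ := clm_norm_pos f hf
  -- move z into D
  obtain ⟨e, he1, he2⟩ := cone_smul_small f hf (α / 2) hα2 (ε d r - dist z xx) (by linarith)
  obtain ⟨z', ⟨hz'1, hz'2⟩, hz'D⟩ := hdense
    (ball z (ε d r - dist z xx) ∩ {y : V | α / 2 * ‖y - z‖ * ‖f‖ < f (y - z)})
    (isOpen_ball.inter (isOpen_lt (by fun_prop) (by fun_prop)))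
    ⟨z + e, by simpa using he1, by simpa using he2⟩
  have hz'x : dist z' xx < ε d r := by
    rw [mem_ball] at hz'1
    linarith [dist_triangle z' z xx]
  have hmiss' : ∀ y : V, (y : X) ∈ ball d (r : ℝ) → y ∈ KV →
      f (y - z') ≤ α / 2 * ‖y - z'‖ * ‖f‖ := by
    intro y hy hyK
    by_contra! hlt
    refine absurd (hmiss y hy hyK) (not_le.2 ?_)
    have e1 : y - z = (y - z') + (z' - z) := by abel
    have e2 : ‖y - z‖ ≤ ‖y - z'‖ + ‖z' - z‖ := e1 ▸ norm_add_le _ _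
    have e3 : f (y - z) = f (y - z') + f (z' - z) := by rw [e1, map_add]
    have e4 : α / 2 * ‖y - z‖ * ‖f‖ ≤ α / 2 * (‖y - z'‖ + ‖z' - z‖) * ‖f‖ := by gcongr
    have hz'2' : α / 2 * ‖z' - z‖ * ‖f‖ < f (z' - z) := hz'2
    rw [e3]
    nlinarith
  -- choose u
  obtain ⟨u₀, hu₀⟩ := exists_half_norm f hf (1 / 2) (by norm_num)
  obtain ⟨u, hu, huD⟩ := hdense {y : V | 1 / 2 * ‖y‖ * ‖f‖ < f y}
    (isOpen_lt (by fun_prop) (by fun_prop)) ⟨u₀, hu₀⟩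
  have hu' : 1 / 2 * ‖u‖ * ‖f‖ < f u := hu
  have hu0 : (u : X) ≠ 0 := by
    intro h0
    have : u = 0 := Subtype.ext h0
    subst this
    simp at hu'
  obtain ⟨g, hg1, hg2⟩ := exists_extension_norm_eq V f
  obtain ⟨hFs, hFw⟩ := hF d r z' u hne hz'x hu0
  obtain ⟨s, hs, hlt⟩ := hFw (‖f‖⁻¹ • g) (by
      rw [norm_smul, hg2, norm_inv, Real.norm_of_nonneg hfpos.le, inv_mul_cancel₀ hfpos.ne']) (by
      rw [ContinuousLinearMap.smul_apply, hg1, smul_eq_mul, ← div_eq_inv_mul, le_div_iff₀ hfpos]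
      have : ‖(u : X)‖ = ‖u‖ := rfl
      rw [this]; linarith)
  have hsD := hFD d hd z' hz'D u huD r hs
  let s' : V := ⟨s, hDV hsD⟩
  have h1 := hmiss' s' (hFs hs).2 (hFs hs).1
  rw [ContinuousLinearMap.smul_apply, smul_eq_mul, ← div_eq_inv_mul, lt_div_iff₀ hfpos] at hlt
  have h2 : g (s - z') = f (s' - z') := hg1 (s' - z')
  have h3 : ‖s - (z' : X)‖ = ‖s' - z'‖ := rfl
  rw [h2, h3] at hlt
  linarith

theorem case_small {X : Type*} [NormedAddCommGroup X] [NormedSpace ℝ X]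
    (V₀ : Subspace ℝ X) (hV₀ : TopologicalSpace.SeparableSpace V₀)
    (A : Set X) (hA : ConeSmall A) :
    ∃ V : Subspace ℝ X, IsClosed (V : Set X) ∧ TopologicalSpace.SeparableSpace V ∧ V₀ ≤ V ∧
      ConeSmall {x : V | (x : X) ∈ A} := by
  have hk : ∀ k : ℕ, SigmaConePorous (1 / ((k : ℝ) + 2)) A := fun k => by
    refine hA _ ⟨by positivity, ?_⟩
    rw [div_lt_one (by positivity)]
    linarith [(Nat.cast_nonneg k : (0 : ℝ) ≤ k)]
  choose g hg hgA using hk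
  have hch : ∀ (d : X) (a : (ℕ × ℕ) × (ℕ × ℕ)), ∃ z w : X,
      (∃ z ∈ ball d (1 / ((a.2.2 : ℝ) + 1)), ∃ f : X →L[ℝ] ℝ, f ≠ 0 ∧
        ∀ y ∈ ball d (1 / ((a.2.1 : ℝ) + 1)), y ∈ g a.1.1 a.1.2 →
          f (y - z) ≤ 1 / ((a.1.1 : ℝ) + 2) * ‖y - z‖ * ‖f‖) →
      z ∈ ball d (1 / ((a.2.2 : ℝ) + 1)) ∧ ∃ f : X →L[ℝ] ℝ, 1 / 2 * ‖w‖ * ‖f‖ < f w ∧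
        ∀ y ∈ ball d (1 / ((a.2.1 : ℝ) + 1)), y ∈ g a.1.1 a.1.2 →
          f (y - z) ≤ 1 / ((a.1.1 : ℝ) + 2) * ‖y - z‖ * ‖f‖ := by
    intro d a
    by_cases h : (∃ z ∈ ball d (1 / ((a.2.2 : ℝ) + 1)), ∃ f : X →L[ℝ] ℝ, f ≠ 0 ∧
        ∀ y ∈ ball d (1 / ((a.2.1 : ℝ) + 1)), y ∈ g a.1.1 a.1.2 →
          f (y - z) ≤ 1 / ((a.1.1 : ℝ) + 2) * ‖y - z‖ * ‖f‖)
    · obtain ⟨z, hz, f, hf, h⟩ := h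
      obtain ⟨w, hw⟩ := exists_half_norm f hf (1 / 2) (by norm_num)
      exact ⟨z, w, fun _ => ⟨hz, f, hw, h⟩⟩
    · exact ⟨0, 0, fun h' => absurd h' h⟩
  choose z w hzw using hch
  obtain ⟨V, D, hVc, hVs, hV₀V, hVD, hDne, hD⟩ := exists_subspace
    (fun d _ _ => ⋃ a, {z d a, w d a})
    (fun d _ _ => Set.countable_iUnion fun a => (Set.toFinite _).countable) V₀ hV₀
  have hDV : D ⊆ V := hVD ▸ subset_closure
  have hzV : ∀ d ∈ D, ∀ a, z d a ∈ V := fun d hd a =>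
    hDV (hD d hd d hd d hd (Set.mem_iUnion.2 ⟨a, by simp⟩))
  have hwV : ∀ d ∈ D, ∀ a, w d a ∈ V := fun d hd a =>
    hDV (hD d hd d hd d hd (Set.mem_iUnion.2 ⟨a, by simp⟩))
  refine ⟨V, hVc, hVs, hV₀V, ?_⟩
  intro α hα
  obtain ⟨k, hk⟩ := exists_nat_one_div_lt (half_pos hα.1)
  have hkα : 2 * (1 / ((k : ℝ) + 2)) ≤ α := by
    have : 1 / ((k : ℝ) + 2) ≤ 1 / ((k : ℝ) + 1) := by
      apply one_div_le_one_div_of_le <;> linarith [(Nat.cast_nonneg k : (0 : ℝ) ≤ k)]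
    linarith
  refine sigma_of_subset (fun n => {x : V | (x : X) ∈ g k n}) ?_ ?_
  · intro n x hx
    obtain ⟨R, hR, h⟩ := (porousAt_iff _ _ _).1 (hg k n x hx)
    obtain ⟨p, hp⟩ := exists_nat_one_div_lt (half_pos hR)
    have hp0 : (0 : ℝ) < 1 / ((p : ℝ) + 1) := by positivity
    refine (porousAt_iff _ _ _).2 ⟨1 / ((p : ℝ) + 1) / 2, half_pos hp0, fun ε hε => ?_⟩
    obtain ⟨q, hq⟩ := exists_nat_one_div_lt (half_pos hε)
    have hq0 : (0 : ℝ) < 1 / ((q : ℝ) + 1) := by positivity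
    have hxc : (x : X) ∈ closure D := by rw [← hVD]; exact x.2
    obtain ⟨d, hd, hdx⟩ := Metric.mem_closure_iff.1 hxc
      (min (1 / ((p : ℝ) + 1) / 2) (1 / ((q : ℝ) + 1) / 2)) (lt_min (half_pos hp0) (half_pos hq0))
    have hd1 : dist (x : X) d < 1 / ((p : ℝ) + 1) / 2 := hdx.trans_le (min_le_left _ _)
    have hd2 : dist (x : X) d < 1 / ((q : ℝ) + 1) / 2 := hdx.trans_le (min_le_right _ _)
    obtain ⟨hz, f, hfw, hf⟩ := hzw d ((k, n), (p, q)) (by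
      obtain ⟨z, hz, f, hf, h⟩ := h (1 / ((q : ℝ) + 1) / 2) (half_pos hq0)
      refine ⟨z, ?_, f, hf, fun y hy hyg => h y ?_ hyg⟩
      · rw [mem_ball] at hz ⊢
        simp only
        linarith [dist_triangle z x d]
      · simp only [mem_ball] at hy ⊢
        linarith [dist_triangle_right y x d])
    simp only at hz hfw hf
    set zz := z d ((k, n), (p, q)) with hzz
    set ww := w d ((k, n), (p, q)) with hww
    let z' : V := ⟨zz, hzV d hd _⟩
    let w' : V := ⟨ww, hwV d hd _⟩
    let f' : V →L[ℝ] ℝ := f.comp V.subtypeL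
    have hf'w : f ww ≤ ‖f'‖ * ‖ww‖ := (le_abs_self _).trans (f'.le_opNorm w')
    have hwpos : 0 < ‖ww‖ := by
      rw [norm_pos_iff]
      intro h0
      rw [h0] at hfw
      simp at hfw
    have hnorm : ‖f‖ ≤ 2 * ‖f'‖ := by
      have : ‖f‖ * ‖ww‖ ≤ 2 * ‖f'‖ * ‖ww‖ := by linarith
      exact le_of_mul_le_mul_right this hwpos
    refine ⟨z', ?_, f', ?_, ?_⟩
    · show dist zz x < ε
      rw [mem_ball] at hz
      linarith [dist_triangle_right zz x d]
    · intro h0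
      have : f ww = f' w' := rfl
      rw [this, h0] at hfw
      have h3 : 0 ≤ 1 / 2 * ‖ww‖ * ‖f‖ := by positivity
      simp at hfw
      linarith
    · intro y hy hyg
      have hy' : (y : X) ∈ ball d (1 / ((p : ℝ) + 1)) := by
        have : dist (y : X) x < 1 / ((p : ℝ) + 1) / 2 := hy
        rw [mem_ball]
        linarith [dist_triangle (y : X) x d]
      have h1 : f' (y - z') ≤ 1 / ((k : ℝ) + 2) * ‖y - z'‖ * ‖f‖ := hf y hy' hyg
      refine h1.trans ?_
      calc 1 / ((k : ℝ) + 2) * ‖y - z'‖ * ‖f‖ ≤ 1 / ((k : ℝ) + 2) * ‖y - z'‖ * (2 * ‖f'‖) := by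
            gcongr
        _ = (2 * (1 / ((k : ℝ) + 2))) * ‖y - z'‖ * ‖f'‖ := by ring
        _ ≤ α * ‖y - z'‖ * ‖f'‖ := by gcongr
  · intro x hx
    have hx' : (x : X) ∈ A := hx
    rw [hgA k] at hx'
    obtain ⟨n, hn⟩ := Set.mem_iUnion.1 hx'
    exact Set.mem_iUnion.2 ⟨n, hn⟩

def LipS {E Y : Type*} [NormedAddCommGroup E] [NormedAddCommGroup Y]
    (g : E → Y) (n : ℕ) : Set E :=
  {x | ∀ y ∈ ball x (1 / ((n : ℝ) + 1)), ‖g y - g x‖ ≤ n * ‖y - x‖}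

def CondS {E Y : Type*} [NormedAddCommGroup E] [NormedSpace ℝ E] [NormedAddCommGroup Y]
    [NormedSpace ℝ Y] (g : E → Y) (n : ℕ) (ε δ : ℝ) : Set E :=
  {x | ∀ y₁ ∈ ball x δ, ∀ y₂ ∈ ball x δ, ∀ y₃ ∈ ball x δ, ∀ s t : ℝ,
    ‖g y₃ - g x - s • (g y₁ - g x) - t • (g y₂ - g x)‖ ≤
      ε * (‖y₃ - x‖ + |s| * ‖y₁ - x‖ + |t| * ‖y₂ - x‖) +
      n * ‖y₃ - x - s • (y₁ - x) - t • (y₂ - x)‖}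

section diff
variable {E Y : Type*} [NormedAddCommGroup E] [NormedSpace ℝ E] [NormedAddCommGroup Y]
    [NormedSpace ℝ Y]

theorem lipS_closed (g : E → Y) (n : ℕ) : IsClosed (LipS g n) := by
  rw [← closure_subset_iff_isClosed]
  intro x hx y hy
  have hδ : (0 : ℝ) < 1 / ((n : ℝ) + 1) := by positivity
  have hn : (0 : ℝ) ≤ n := Nat.cast_nonneg n
  refine le_of_forall_pos_le_add fun e he => ?_
  rw [mem_ball] at hy
  have hη : 0 < e / (2 * n + 1) := by positivity
  obtain ⟨x', hx', hd⟩ := Metric.mem_closure_iff.1 hx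
    (min (e / (2 * n + 1)) (1 / ((n : ℝ) + 1) - dist y x)) (lt_min hη (by linarith))
  have hd1 := hd.trans_le (min_le_left _ _)
  have hd2 := hd.trans_le (min_le_right _ _)
  have hyx := dist_nonneg (x := y) (y := x)
  have h1 := hx' x (by rw [mem_ball]; linarith)
  have h2 := hx' y (by rw [mem_ball]; linarith [dist_triangle y x x'])
  have h3 : ‖g y - g x‖ ≤ ‖g y - g x'‖ + ‖g x - g x'‖ := by
    have := norm_sub_le (g y - g x') (g x - g x')
    simpa using this
  have h4 : ‖y - x'‖ ≤ ‖y - x‖ + ‖x - x'‖ := norm_sub_le_norm_sub_add_norm_sub _ _ _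
  rw [dist_eq_norm] at hd1
  rw [lt_div_iff₀ (by positivity)] at hd1
  have h5 : (n : ℝ) * ‖y - x'‖ ≤ n * (‖y - x‖ + ‖x - x'‖) := by gcongr
  have h6 := norm_nonneg (x - x')
  nlinarith

theorem lipS_cont (g : E → Y) (n : ℕ) (x : E) (hx : x ∈ LipS g n) : ContinuousAt g x := by
  have hδ : (0 : ℝ) < 1 / ((n : ℝ) + 1) := by positivity
  refine ContinuousAt.congr_of_eventuallyEq ?_ (EventuallyEq.refl _ _)
  rw [ContinuousAt, tendsto_iff_norm_sub_tendsto_zero]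
  refine squeeze_zero' (Eventually.of_forall fun _ => norm_nonneg _)
    (Filter.eventually_of_mem (ball_mem_nhds x hδ) fun y hy => hx y hy) ?_
  have : Tendsto (fun y : E => (n : ℝ) * ‖y - x‖) (𝓝 x) (𝓝 ((n : ℝ) * ‖x - x‖)) :=
    Continuous.tendsto (by fun_prop) x
  simpa using this

theorem condS_open (g : E → Y) (n : ℕ) (ε δ : ℝ) :
    LipS g n ∩ (CondS g n ε δ)ᶜ = LipS g n ∩ interior (CondS g n ε δ)ᶜ := by
  apply Set.Subset.antisymm
  · rintro x ⟨hx, hc⟩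
    refine ⟨hx, ?_⟩
    rw [mem_interior_iff_mem_nhds]
    have hg := lipS_cont g n x hx
    simp only [CondS, Set.mem_compl_iff, Set.mem_ofPred_eq] at hc
    push Not at hc
    obtain ⟨y₁, h1, y₂, h2, y₃, h3, s, t, hlt⟩ := hc
    have e : ∀ y ∈ ball x δ, ∀ᶠ x' in 𝓝 x, y ∈ ball x' δ := by
      intro y hy
      filter_upwards [isOpen_ball.mem_nhds (mem_ball_comm.1 hy)] with x' hx'
      exact mem_ball_comm.1 hx'
    have e4 := ContinuousAt.eventually_lt
      (f := fun x => ε * (‖y₃ - x‖ + |s| * ‖y₁ - x‖ + |t| * ‖y₂ - x‖) +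
        n * ‖y₃ - x - s • (y₁ - x) - t • (y₂ - x)‖)
      (g := fun x => ‖g y₃ - g x - s • (g y₁ - g x) - t • (g y₂ - g x)‖) (x₀ := x)
      (by fun_prop) (by fun_prop) hlt
    filter_upwards [e y₁ h1, e y₂ h2, e y₃ h3, e4] with x' a1 a2 a3 a4 hcon
    exact absurd (hcon y₁ a1 y₂ a2 y₃ a3 s t) (not_le.2 a4)
  · exact Set.inter_subset_inter_right _ interior_subset

def PieceB (G : Set E) (g : E → Y) (n m : ℕ) : Set E :=
  G ∩ (LipS g n ∩ ⋂ k : ℕ, (CondS g n (1 / ((m : ℝ) + 1)) (1 / ((k : ℝ) + 1)))ᶜ)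

def PieceA (G : Set E) (g : E → Y) : Set E := G ∩ ⋂ n : ℕ, (LipS g n)ᶜ

theorem pieceA_Gδ (G : Set E) (hG : IsOpen G) (g : E → Y) : IsGδ (PieceA G g) :=
  hG.isGδ.inter (IsGδ.iInter fun n => (lipS_closed g n).isOpen_compl.isGδ)

theorem pieceB_Gδ (G : Set E) (hG : IsOpen G) (g : E → Y) (n m : ℕ) : IsGδ (PieceB G g n m) := by
  unfold PieceB
  rw [Set.inter_iInter]
  simp only [condS_open]
  exact hG.isGδ.inter (IsGδ.iInter fun k => (lipS_closed g n).isGδ.inter isOpen_interior.isGδ)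

theorem diff_lipS (g : E → Y) (x : E) (h : DifferentiableAt ℝ g x) : ∃ n, x ∈ LipS g n := by
  obtain ⟨C, hC⟩ := (h.hasFDerivAt.isBigO_sub).bound
  obtain ⟨δ, hδ, hb⟩ := Metric.eventually_nhds_iff.1 hC
  obtain ⟨n₁, hn₁⟩ := exists_nat_ge C
  obtain ⟨n₂, hn₂⟩ := exists_nat_one_div_lt hδ
  refine ⟨max n₁ n₂, fun y hy => ?_⟩
  rw [mem_ball] at hy
  have h1 : (n₁ : ℝ) ≤ ((max n₁ n₂ : ℕ) : ℝ) := by exact_mod_cast le_max_left _ _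
  have h2 : (n₂ : ℝ) ≤ ((max n₁ n₂ : ℕ) : ℝ) := by exact_mod_cast le_max_right _ _
  have h3 : 1 / (((max n₁ n₂ : ℕ) : ℝ) + 1) ≤ 1 / ((n₂ : ℝ) + 1) := by
    apply one_div_le_one_div_of_le (by positivity); linarith
  refine (hb (by linarith)).trans ?_
  gcongr
  linarith

theorem diff_condS (g : E → Y) (x : E) (n : ℕ) (hn : x ∈ LipS g n) (h : DifferentiableAt ℝ g x)
    (ε : ℝ) (hε : 0 < ε) : ∃ k : ℕ, x ∈ CondS g n ε (1 / ((k : ℝ) + 1)) := by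
  have hδ : (0 : ℝ) < 1 / ((n : ℝ) + 1) := by positivity
  obtain ⟨L, hL⟩ := h
  have hLn : ‖L‖ ≤ n := hL.le_of_lip' (Nat.cast_nonneg n)
    (Filter.eventually_of_mem (ball_mem_nhds x hδ) fun y hy => hn y hy)
  obtain ⟨δ, hδ, hb⟩ := Metric.eventually_nhds_iff.1 (hL.isLittleO.def hε)
  obtain ⟨k, hk⟩ := exists_nat_one_div_lt hδ
  refine ⟨k, fun y₁ h₁ y₂ h₂ y₃ h₃ s t => ?_⟩
  have b₁ := hb (h₁.trans hk)
  have b₂ := hb (h₂.trans hk)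
  have b₃ := hb (h₃.trans hk)
  have e : g y₃ - g x - s • (g y₁ - g x) - t • (g y₂ - g x) =
      (g y₃ - g x - L (y₃ - x)) - s • (g y₁ - g x - L (y₁ - x)) - t • (g y₂ - g x - L (y₂ - x))
      + L (y₃ - x - s • (y₁ - x) - t • (y₂ - x)) := by
    simp only [map_sub, map_smul, smul_sub]
    abel
  rw [e]
  have hL2 : ‖L (y₃ - x - s • (y₁ - x) - t • (y₂ - x))‖ ≤
      n * ‖y₃ - x - s • (y₁ - x) - t • (y₂ - x)‖ := L.le_of_opNorm_le hLn _
  have c₁ : ‖s • (g y₁ - g x - L (y₁ - x))‖ ≤ |s| * (ε * ‖y₁ - x‖) := by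
    rw [norm_smul, Real.norm_eq_abs]; gcongr
  have c₂ : ‖t • (g y₂ - g x - L (y₂ - x))‖ ≤ |t| * (ε * ‖y₂ - x‖) := by
    rw [norm_smul, Real.norm_eq_abs]; gcongr
  refine (norm_add_le _ _).trans (add_le_add ?_ hL2)
  refine (norm_sub_le _ _).trans ?_
  have := norm_sub_le (g y₃ - g x - L (y₃ - x)) (s • (g y₁ - g x - L (y₁ - x)))
  linarith

theorem diff_of_condS [CompleteSpace Y] (g : E → Y) (x : E) (n : ℕ) (hn : x ∈ LipS g n)
    (h : ∀ m : ℕ, ∃ k : ℕ, x ∈ CondS g n (1 / ((m : ℝ) + 1)) (1 / ((k : ℝ) + 1))) :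
    DifferentiableAt ℝ g x := by
  let φ : E → Y := fun v => g (x + v) - g x
  have hφ : ∀ ε > (0 : ℝ), ∃ δ > (0 : ℝ), ∀ v₁ v₂ : E, ‖v₁‖ < δ → ‖v₂‖ < δ → ∀ s t : ℝ,
      ‖s • v₁ + t • v₂‖ < δ →
      ‖φ (s • v₁ + t • v₂) - s • φ v₁ - t • φ v₂‖ ≤ 2 * ε * (|s| * ‖v₁‖ + |t| * ‖v₂‖) := by
    intro ε hε
    obtain ⟨m, hm⟩ := exists_nat_one_div_lt hε
    obtain ⟨k, hk⟩ := h m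
    refine ⟨1 / ((k : ℝ) + 1), by positivity, fun v₁ v₂ h₁ h₂ s t h₃ => ?_⟩
    have := hk (x + v₁) (by simpa using h₁) (x + v₂) (by simpa using h₂)
      (x + (s • v₁ + t • v₂)) (by simpa using h₃) s t
    simp only [add_sub_cancel_left] at this
    rw [sub_self, norm_zero, mul_zero, add_zero] at this
    refine this.trans ?_
    have h4 : ‖s • v₁ + t • v₂‖ ≤ |s| * ‖v₁‖ + |t| * ‖v₂‖ := by
      refine (norm_add_le _ _).trans ?_
      rw [norm_smul, norm_smul, Real.norm_eq_abs, Real.norm_eq_abs]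
    have h5 : 0 ≤ |s| * ‖v₁‖ + |t| * ‖v₂‖ := by positivity
    calc 1 / ((m : ℝ) + 1) * (‖s • v₁ + t • v₂‖ + |s| * ‖v₁‖ + |t| * ‖v₂‖)
        ≤ ε * (‖s • v₁ + t • v₂‖ + |s| * ‖v₁‖ + |t| * ‖v₂‖) := by gcongr
      _ ≤ ε * (2 * (|s| * ‖v₁‖ + |t| * ‖v₂‖)) := by
          apply mul_le_mul_of_nonneg_left _ hε.le; linarith
      _ = _ := by ring
  let τ : ℕ → ℝ := fun j => 1 / ((j : ℝ) + 1)
  have hτ0 : ∀ j, 0 < τ j := fun j => by positivity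
  have hτ1 : ∀ j, τ j ≤ 1 := fun j => by
    show 1 / ((j : ℝ) + 1) ≤ 1
    rw [div_le_one (by positivity)]
    linarith [(Nat.cast_nonneg j : (0 : ℝ) ≤ j)]
  have hτ : Tendsto τ atTop (𝓝 0) := tendsto_one_div_add_atTop_nhds_zero_nat
  have hsm : ∀ (v : E) (δ : ℝ), 0 < δ → ∀ᶠ j in atTop, ‖τ j • v‖ < δ := by
    intro v δ hδ
    have : Tendsto (fun j => ‖τ j • v‖) atTop (𝓝 ‖(0 : ℝ) • v‖) := (hτ.smul_const v).norm
    rw [zero_smul, norm_zero] at this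
    exact this.eventually_lt_const hδ
  let u : E → ℕ → Y := fun v j => (τ j)⁻¹ • φ (τ j • v)
  -- comparison
  have hcmp : ∀ ε > (0 : ℝ), ∃ δ > (0 : ℝ), ∀ (v : E) (a b : ℝ), 0 < a → 0 < b →
      ‖a • v‖ < δ → ‖b • v‖ < δ →
      ‖a⁻¹ • φ (a • v) - b⁻¹ • φ (b • v)‖ ≤ 2 * ε * ‖v‖ := by
    intro ε hε
    obtain ⟨δ, hδ, H⟩ := hφ ε hε
    refine ⟨δ, hδ, fun v a b ha hb h1 h2 => ?_⟩
    have e : (a / b) • (b • v) + (0 : ℝ) • (b • v) = a • v := by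
      rw [zero_smul, add_zero, smul_smul, div_mul_cancel₀ _ hb.ne']
    have := H (b • v) (b • v) h2 h2 (a / b) 0 (by rwa [e])
    rw [e] at this
    simp only [zero_smul, sub_zero, abs_zero, zero_mul, add_zero] at this
    have e2 : a⁻¹ • φ (a • v) - b⁻¹ • φ (b • v) = a⁻¹ • (φ (a • v) - (a / b) • φ (b • v)) := by
      rw [smul_sub a⁻¹ (φ (a • v)), smul_smul]
      congr 2
      field_simp
    rw [e2, norm_smul, norm_inv, Real.norm_of_nonneg ha.le]
    rw [norm_smul, abs_of_pos (div_pos ha hb), Real.norm_of_nonneg hb.le] at this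
    rw [inv_mul_le_iff₀ ha]
    refine this.trans (le_of_eq ?_)
    field_simp
  have hcauchy : ∀ v, ∃ l, Tendsto (u v) atTop (𝓝 l) := by
    intro v
    apply cauchySeq_tendsto_of_complete
    rw [Metric.cauchySeq_iff]
    intro e he
    obtain ⟨δ, hδ, H⟩ := hcmp (e / (2 * (‖v‖ + 1))) (by positivity)
    obtain ⟨N, hN⟩ := eventually_atTop.1 (hsm v δ hδ)
    refine ⟨N, fun i hi j hj => ?_⟩
    rw [dist_eq_norm]
    refine (H v (τ i) (τ j) (hτ0 i) (hτ0 j) (hN i hi) (hN j hj)).trans_lt ?_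
    have : 2 * (e / (2 * (‖v‖ + 1))) * ‖v‖ = e * (‖v‖ / (‖v‖ + 1)) := by field_simp
    rw [this]
    have h1 : ‖v‖ / (‖v‖ + 1) < 1 := by
      rw [div_lt_one (by positivity)]; linarith
    nlinarith
  choose L hL using hcauchy
  have happ : ∀ ε > (0 : ℝ), ∃ δ > (0 : ℝ), ∀ v, ‖v‖ < δ → ‖φ v - L v‖ ≤ 2 * ε * ‖v‖ := by
    intro ε hε
    obtain ⟨δ, hδ, H⟩ := hcmp ε hε
    refine ⟨δ, hδ, fun v hv => ?_⟩
    have h1 : Tendsto (fun j => ‖φ v - u v j‖) atTop (𝓝 ‖φ v - L v‖) :=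
      (tendsto_const_nhds.sub (hL v)).norm
    refine le_of_tendsto h1 ?_
    filter_upwards [hsm v δ hδ] with j hj
    have := H v 1 (τ j) one_pos (hτ0 j) (by simpa using hv) hj
    simpa using this
  have hlin : ∀ (v₁ v₂ : E) (s t : ℝ), L (s • v₁ + t • v₂) = s • L v₁ + t • L v₂ := by
    intro v₁ v₂ s t
    have h1 : Tendsto (fun j => ‖u (s • v₁ + t • v₂) j - s • u v₁ j - t • u v₂ j‖) atTop
        (𝓝 ‖L (s • v₁ + t • v₂) - s • L v₁ - t • L v₂‖) :=
      (((hL _).sub ((hL v₁).const_smul s)).sub ((hL v₂).const_smul t)).norm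
    have h2 : ∀ ε > (0 : ℝ), ‖L (s • v₁ + t • v₂) - s • L v₁ - t • L v₂‖ ≤
        2 * ε * (|s| * ‖v₁‖ + |t| * ‖v₂‖) := by
      intro ε hε
      obtain ⟨δ, hδ, H⟩ := hφ ε hε
      refine le_of_tendsto h1 ?_
      filter_upwards [hsm v₁ δ hδ, hsm v₂ δ hδ, hsm (s • v₁ + t • v₂) δ hδ] with j a1 a2 a3
      have e : s • τ j • v₁ + t • τ j • v₂ = τ j • (s • v₁ + t • v₂) := by
        rw [smul_add, smul_comm s, smul_comm t]
      have := H (τ j • v₁) (τ j • v₂) a1 a2 s t (by rwa [e])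
      rw [e] at this
      have e2 : u (s • v₁ + t • v₂) j - s • u v₁ j - t • u v₂ j =
          (τ j)⁻¹ • (φ (τ j • (s • v₁ + t • v₂)) - s • φ (τ j • v₁) - t • φ (τ j • v₂)) := by
        simp only [u, smul_sub]
        rw [smul_comm s, smul_comm t]
      rw [e2, norm_smul, norm_inv, Real.norm_of_nonneg (hτ0 j).le, inv_mul_le_iff₀ (hτ0 j)]
      refine this.trans (le_of_eq ?_)
      rw [norm_smul, norm_smul, Real.norm_of_nonneg (hτ0 j).le]
      ring
    have h3 : ‖L (s • v₁ + t • v₂) - s • L v₁ - t • L v₂‖ ≤ 0 := by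
      refine le_of_forall_pos_le_add fun e he => ?_
      set C := |s| * ‖v₁‖ + |t| * ‖v₂‖ with hC
      have hC0 : 0 ≤ C := by positivity
      refine (h2 (e / (2 * (C + 1))) (by positivity)).trans ?_
      have : 2 * (e / (2 * (C + 1))) * C = e * (C / (C + 1)) := by field_simp
      rw [this]
      have h1 : C / (C + 1) ≤ 1 := by
        rw [div_le_one (by positivity)]; linarith
      nlinarith
    have h4 := norm_le_zero_iff.1 h3
    rw [sub_sub, sub_eq_zero] at h4
    exact h4
  have hδn : (0 : ℝ) < 1 / ((n : ℝ) + 1) := by positivity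
  have hbd : ∀ v, ‖L v‖ ≤ n * ‖v‖ := by
    intro v
    refine le_of_tendsto (hL v).norm ?_
    filter_upwards [hsm v _ hδn] with j hj
    have := hn (x + τ j • v) (by simpa using hj)
    rw [add_sub_cancel_left] at this
    show ‖(τ j)⁻¹ • φ (τ j • v)‖ ≤ _
    rw [norm_smul, norm_inv, Real.norm_of_nonneg (hτ0 j).le, inv_mul_le_iff₀ (hτ0 j)]
    refine this.trans (le_of_eq ?_)
    rw [norm_smul, Real.norm_of_nonneg (hτ0 j).le]
    ring
  let L' : E →ₗ[ℝ] Y :=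
    { toFun := L
      map_add' := fun a b => by simpa using hlin a b 1 1
      map_smul' := fun c a => by simpa using hlin a a c 0 }
  let L'' : E →L[ℝ] Y := L'.mkContinuous n hbd
  refine ⟨L'', ?_⟩
  rw [hasFDerivAt_iff_isLittleO_nhds_zero, Asymptotics.isLittleO_iff]
  intro e he
  obtain ⟨δ, hδ, H⟩ := happ (e / 2) (half_pos he)
  filter_upwards [ball_mem_nhds (0 : E) hδ] with v hv
  have := H v (by simpa using hv)
  calc _ ≤ 2 * (e / 2) * ‖v‖ := this
    _ = e * ‖v‖ := by ring

theorem nondiff_subset [CompleteSpace Y] (G : Set E) (g : E → Y) :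
    {x ∈ G | ¬ DifferentiableAt ℝ g x} ⊆
      PieceA G g ∪ ⋃ p : ℕ × ℕ, PieceB G g p.1 p.2 := by
  rintro x ⟨hx, hd⟩
  by_cases h : ∃ n, x ∈ LipS g n
  · obtain ⟨n, hn⟩ := h
    right
    by_contra hcon
    apply hd
    refine diff_of_condS g x n hn fun m => ?_
    by_contra hm
    apply hcon
    refine Set.mem_iUnion.2 ⟨(n, m), hx, hn, Set.mem_iInter.2 fun k hk => hm ⟨k, hk⟩⟩
  · exact Or.inl ⟨hx, Set.mem_iInter.2 fun n hn => h ⟨n, hn⟩⟩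

theorem pieceA_subset (G : Set E) (g : E → Y) :
    PieceA G g ⊆ {x | x ∈ G ∧ ¬ DifferentiableAt ℝ g x} := by
  rintro x ⟨hx, hA⟩
  refine ⟨hx, fun hd => ?_⟩
  obtain ⟨n, hn⟩ := diff_lipS g x hd
  exact Set.mem_iInter.1 hA n hn

theorem pieceB_subset (G : Set E) (g : E → Y) (n m : ℕ) :
    PieceB G g n m ⊆ {x | x ∈ G ∧ ¬ DifferentiableAt ℝ g x} := by
  rintro x ⟨hx, hn, hB⟩
  refine ⟨hx, fun hd => ?_⟩
  obtain ⟨k, hk⟩ := diff_condS g x n hn hd (1 / ((m : ℝ) + 1)) (by positivity)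
  exact Set.mem_iInter.1 hB k hk

end diff

theorem case_big {X : Type*} [NormedAddCommGroup X] [NormedSpace ℝ X] [CompleteSpace X]
    {Y : Type*} [NormedAddCommGroup Y] [NormedSpace ℝ Y] [CompleteSpace Y]
    (G : Set X) (hG : IsOpen G) (f : X → Y)
    (V₀ : Subspace ℝ X) (hV₀ : TopologicalSpace.SeparableSpace V₀)
    {α : ℝ} (hα : α ∈ Ioo (0 : ℝ) 1)
    (hn : ¬ SigmaConePorous α {x ∈ G | ¬ DifferentiableAt ℝ f x}) :
    ∃ V : Subspace ℝ X, IsClosed (V : Set X) ∧ TopologicalSpace.SeparableSpace V ∧ V₀ ≤ V ∧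
      ¬ SigmaConePorous (α / 2) {x : V | (x : X) ∈ G ∧
          ¬ DifferentiableAt ℝ (fun y : V => f (y : X)) x} := by
  have hsplit : ¬ SigmaConePorous α (PieceA G f) ∨
      ∃ n m, ¬ SigmaConePorous α (PieceB G f n m) := by
    by_contra! hcon
    exact hn (sigma_mono le_rfl (nondiff_subset G f) (sigma_union hcon.1
      (sigma_iUnion _ fun p => hcon.2 p.1 p.2)))
  rcases hsplit with hA | ⟨n, m, hB⟩
  · have hw : ∀ (x : X) (n : ℕ), ∃ y, x ∉ LipS f n →
        y ∈ ball x (1 / ((n : ℝ) + 1)) ∧ ¬ ‖f y - f x‖ ≤ n * ‖y - x‖ := by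
      intro x n
      by_cases h : x ∈ LipS f n
      · exact ⟨0, fun h' => absurd h h'⟩
      · simp only [LipS, Set.mem_ofPred_eq] at h
        push Not at h
        obtain ⟨y, h1, h2⟩ := h
        exact ⟨y, fun _ => ⟨h1, not_le.2 h2⟩⟩
    choose y hy using hw
    obtain ⟨V, h1, h2, h3, h4⟩ := core V₀ hV₀ hα _ (pieceA_Gδ G hG f) hA
      (fun x => Set.range (y x)) (fun x => Set.countable_range _)
    refine ⟨V, h1, h2, h3, fun hcon => ?_⟩
    have hGV : IsOpen {x : V | (x : X) ∈ G} := hG.preimage continuous_subtype_val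
    refine h4 (PieceA {x : V | (x : X) ∈ G} (fun y : V => f (y : X))) (pieceA_Gδ _ hGV _) ?_
      (sigma_mono le_rfl (pieceA_subset _ _) hcon)
    rintro x ⟨hxG, hxA⟩ hc
    refine ⟨hxG, Set.mem_iInter.2 fun n hn => ?_⟩
    obtain ⟨a, b⟩ := hy x n (Set.mem_iInter.1 hxA n)
    exact b (hn ⟨y x n, hc ⟨n, rfl⟩⟩ a)
  · have hw : ∀ (x : X) (k : ℕ), ∃ y₁ y₂ y₃ : X,
        x ∉ CondS f n (1 / ((m : ℝ) + 1)) (1 / ((k : ℝ) + 1)) →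
        y₁ ∈ ball x (1 / ((k : ℝ) + 1)) ∧ y₂ ∈ ball x (1 / ((k : ℝ) + 1)) ∧
        y₃ ∈ ball x (1 / ((k : ℝ) + 1)) ∧ ∃ s t : ℝ,
        ¬ ‖f y₃ - f x - s • (f y₁ - f x) - t • (f y₂ - f x)‖ ≤
          (1 / ((m : ℝ) + 1)) * (‖y₃ - x‖ + |s| * ‖y₁ - x‖ + |t| * ‖y₂ - x‖) +
          n * ‖y₃ - x - s • (y₁ - x) - t • (y₂ - x)‖ := by
      intro x k
      by_cases h : x ∈ CondS f n (1 / ((m : ℝ) + 1)) (1 / ((k : ℝ) + 1))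
      · exact ⟨0, 0, 0, fun h' => absurd h h'⟩
      · have h' := h
        simp only [CondS, Set.mem_ofPred_eq] at h
        push Not at h
        obtain ⟨y₁, h1, y₂, h2, y₃, h3, s, t, h4⟩ := h
        exact ⟨y₁, y₂, y₃, fun _ => ⟨h1, h2, h3, s, t, not_le.2 h4⟩⟩
    choose y₁ y₂ y₃ hy using hw
    obtain ⟨V, h1, h2, h3, h4⟩ := core V₀ hV₀ hα _ (pieceB_Gδ G hG f n m) hB
      (fun x => Set.range (y₁ x) ∪ Set.range (y₂ x) ∪ Set.range (y₃ x))
      (fun x => ((Set.countable_range _).union (Set.countable_range _)).union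
        (Set.countable_range _))
    refine ⟨V, h1, h2, h3, fun hcon => ?_⟩
    have hGV : IsOpen {x : V | (x : X) ∈ G} := hG.preimage continuous_subtype_val
    refine h4 (PieceB {x : V | (x : X) ∈ G} (fun y : V => f (y : X)) n m) (pieceB_Gδ _ hGV _ _ _)
      ?_ (sigma_mono le_rfl (pieceB_subset _ _ _ _) hcon)
    rintro x ⟨hxG, hxL, hxA⟩ hc
    refine ⟨hxG, fun y hy => hxL y hy, Set.mem_iInter.2 fun k hk => ?_⟩
    obtain ⟨a, b, c, s, t, e⟩ := hy x k (Set.mem_iInter.1 hxA k)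
    exact e (hk ⟨y₁ x k, hc (Or.inl (Or.inl ⟨k, rfl⟩))⟩ a ⟨y₂ x k, hc (Or.inl (Or.inr ⟨k, rfl⟩))⟩ b
      ⟨y₃ x k, hc (Or.inr ⟨k, rfl⟩)⟩ c s t)

/-- Separable determination of cone smallness of the set of points of non-Fréchet
differentiability: for any mapping `f` on an open set `G ⊆ X` with values in a Banach
space `Y` and any separable subspace `V₀ ⊆ X` there is a closed separable subspace
`V ⊇ V₀` such that the set of non-differentiability points of `f` is cone small in `X`
iff the set of non-differentiability points of `f` restricted to `V ∩ G` is cone small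
in `V`. -/
theorem frechet_nondiff_cone_small_separably_determined
    {X : Type*} [NormedAddCommGroup X] [NormedSpace ℝ X] [CompleteSpace X]
    {Y : Type*} [NormedAddCommGroup Y] [NormedSpace ℝ Y] [CompleteSpace Y]
    (G : Set X) (hG : IsOpen G) (f : X → Y)
    (V₀ : Subspace ℝ X) (hV₀ : TopologicalSpace.SeparableSpace V₀) :
    ∃ V : Subspace ℝ X, IsClosed (V : Set X) ∧ TopologicalSpace.SeparableSpace V ∧
      V₀ ≤ V ∧
      (ConeSmall {x ∈ G | ¬ DifferentiableAt ℝ f x} ↔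
        ConeSmall {x : V | (x : X) ∈ G ∧
          ¬ DifferentiableAt ℝ (fun y : V => f (y : X)) x}) := by
  by_cases h : ConeSmall {x ∈ G | ¬ DifferentiableAt ℝ f x}
  · obtain ⟨V, h1, h2, h3, h4⟩ := case_small V₀ hV₀ _ h
    refine ⟨V, h1, h2, h3, iff_of_true h fun α hα => sigma_mono le_rfl ?_ (h4 α hα)⟩
    rintro x ⟨hx, hd⟩
    refine ⟨hx, fun hf => hd ?_⟩
    exact DifferentiableAt.comp x hf V.subtypeL.differentiableAt
  · have h' := h
    unfold ConeSmall at h'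
    push Not at h'
    obtain ⟨α, hα, hn⟩ := h'
    obtain ⟨V, h1, h2, h3, h4⟩ := case_big G hG f V₀ hV₀ hα hn
    refine ⟨V, h1, h2, h3, iff_of_false h fun hc => h4 (hc (α / 2) ⟨?_, ?_⟩)⟩
    · linarith [hα.1]
    · linarith [hα.1, hα.2]
end
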